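/- arXiv:math/0301231 — 5 statements merged into one kernel-verified Lean document; each statement's English description precedes it below -/
import Mathlib

section
/- Let R be a commutative ring and I an ideal of R. For every short exact sequence 0 → M' → M → M'' → 0 of R-modules there are connecting homomorphisms δ^i : H_I^i(M'') → H_I^{i+1}(M'), natural in the short exact sequence, such that the long sequence 0 → H_I^0(M') → H_I^0(M) → H_I^0(M'') → H_I^1(M') → H_I^1(M) → H_I^1(M'') → H_I^2(M') → ⋯ is exact, where the unlabeled maps are induced by functoriality of H_I^i. -/
open CategoryTheory

universe u

section

open Limits

namespace CategoryTheory

section LeftDerived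

variable {C D : Type*} [Category* C] [Category* D] [Abelian C] [Abelian D]

/-- `F.leftDerived n` at `X` is the homology of `F` applied to the chosen resolution of `X`. -/
noncomputable def Functor.leftDerivedObjIso [HasProjectiveResolutions C] (F : C ⥤ D) [F.Additive]
    (n : ℕ) (X : C) :
    (F.leftDerived n).obj X ≅
      ((F.mapHomologicalComplex _).obj (projectiveResolution X).complex).homology n :=
  (projectiveResolution X).isoLeftDerivedObj F n

lemma Functor.leftDerivedObjIso_hom_naturality [HasProjectiveResolutions C] (F : C ⥤ D)
    [F.Additive] (n : ℕ) {X Y : C} (f : X ⟶ Y) :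
    (F.leftDerived n).map f ≫ (F.leftDerivedObjIso n Y).hom =
      (F.leftDerivedObjIso n X).hom ≫ HomologicalComplex.homologyMap
        ((F.mapHomologicalComplex _).map (ProjectiveResolution.lift f _ _)) n :=
  ProjectiveResolution.isoLeftDerivedObj_hom_naturality f _ _ _
    (ProjectiveResolution.lift_commutes_zero f _ _) F n

lemma NatTrans.leftDerived_app_comp_leftDerivedObjIso_hom [HasProjectiveResolutions C]
    {F G : C ⥤ D} [F.Additive] [G.Additive] (α : F ⟶ G) (n : ℕ) (X : C) :
    (NatTrans.leftDerived α n).app X ≫ (G.leftDerivedObjIso n X).hom =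
      (F.leftDerivedObjIso n X).hom ≫ HomologicalComplex.homologyMap
        ((NatTrans.mapHomologicalComplex α _).app (projectiveResolution X).complex) n :=
  (Iso.eq_comp_inv _).1 ((ProjectiveResolution.leftDerived_app_eq α _ n).trans
    (Category.assoc _ _ _).symm)

/-- A short complex of additive functors, applied degreewise to a chain complex. -/
noncomputable abbrev ShortComplex.mapChainComplex (T : ShortComplex (C ⥤ D))
    [T.X₁.Additive] [T.X₂.Additive] [T.X₃.Additive] (K : ChainComplex C ℕ) :
    ShortComplex (ChainComplex D ℕ) where
  X₁ := (T.X₁.mapHomologicalComplex _).obj K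
  X₂ := (T.X₂.mapHomologicalComplex _).obj K
  X₃ := (T.X₃.mapHomologicalComplex _).obj K
  f := (NatTrans.mapHomologicalComplex T.f _).app K
  g := (NatTrans.mapHomologicalComplex T.g _).app K
  zero := by
    ext n
    exact congr_app T.zero (K.X n)

/-- A short complex of functors is short exact on projective objects. -/
def ShortComplex.ShortExactOnProjectives (T : ShortComplex (C ⥤ D)) : Prop :=
  ∀ (X : C) [Projective X], (T.map ((evaluation C D).obj X)).ShortExact

variable {T T' : ShortComplex (C ⥤ D)}
    [T.X₁.Additive] [T.X₂.Additive] [T.X₃.Additive]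
    [T'.X₁.Additive] [T'.X₂.Additive] [T'.X₃.Additive]

/-- The functoriality of `ShortComplex.mapChainComplex` in the chain complex. -/
noncomputable def ShortComplex.mapChainComplexMap (T : ShortComplex (C ⥤ D))
    [T.X₁.Additive] [T.X₂.Additive] [T.X₃.Additive] {K L : ChainComplex C ℕ} (φ : K ⟶ L) :
    T.mapChainComplex K ⟶ T.mapChainComplex L where
  τ₁ := (T.X₁.mapHomologicalComplex _).map φ
  τ₂ := (T.X₂.mapHomologicalComplex _).map φ
  τ₃ := (T.X₃.mapHomologicalComplex _).map φ
  comm₁₂ := NatTrans.mapHomologicalComplex_naturality _ _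
  comm₂₃ := NatTrans.mapHomologicalComplex_naturality _ _

/-- The functoriality of `ShortComplex.mapChainComplex` in the short complex of functors. -/
noncomputable def ShortComplex.Hom.mapChainComplex (α : T ⟶ T') (K : ChainComplex C ℕ) :
    T.mapChainComplex K ⟶ T'.mapChainComplex K where
  τ₁ := (NatTrans.mapHomologicalComplex α.τ₁ _).app K
  τ₂ := (NatTrans.mapHomologicalComplex α.τ₂ _).app K
  τ₃ := (NatTrans.mapHomologicalComplex α.τ₃ _).app K
  comm₁₂ := by
    ext n
    exact congr_app α.comm₁₂ (K.X n)
  comm₂₃ := by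
    ext n
    exact congr_app α.comm₂₃ (K.X n)

lemma ShortComplex.leftDerived_f_comp_g [HasProjectiveResolutions C] (T : ShortComplex (C ⥤ D))
    [T.X₁.Additive] [T.X₂.Additive] [T.X₃.Additive] (n : ℕ) (X : C) :
    (NatTrans.leftDerived T.f n).app X ≫ (NatTrans.leftDerived T.g n).app X = 0 := by
  rw [← cancel_mono (T.X₃.leftDerivedObjIso n X).hom, Category.assoc,
    NatTrans.leftDerived_app_comp_leftDerivedObjIso_hom, ← Category.assoc,
    NatTrans.leftDerived_app_comp_leftDerivedObjIso_hom, Category.assoc,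
    ← HomologicalComplex.homologyMap_comp,
    (T.mapChainComplex (projectiveResolution X).complex).zero,
    HomologicalComplex.homologyMap_zero, comp_zero, zero_comp]

namespace ShortComplex.ShortExactOnProjectives

lemma mapChainComplex (hT : T.ShortExactOnProjectives) {X : C} (P : ProjectiveResolution X) :
    (T.mapChainComplex P.complex).ShortExact :=
  HomologicalComplex.shortExact_of_degreewise_shortExact _ fun n ↦ hT (P.complex.X n)

variable [HasProjectiveResolutions C]

/-- The connecting morphism between left derived functors. -/
noncomputable def δ (hT : T.ShortExactOnProjectives) (n : ℕ) :
    T.X₃.leftDerived (n + 1) ⟶ T.X₁.leftDerived n where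
  app X := (T.X₃.leftDerivedObjIso (n + 1) X).hom ≫
    (hT.mapChainComplex (projectiveResolution X)).δ (n + 1) n (ComplexShape.down_mk _ _ rfl) ≫
    (T.X₁.leftDerivedObjIso n X).inv
  naturality X Y f := by
    have h := HomologicalComplex.HomologySequence.δ_naturality
      (T.mapChainComplexMap (ProjectiveResolution.lift f
        (projectiveResolution X) (projectiveResolution Y)))
      (hT.mapChainComplex _) (hT.mapChainComplex _) (n + 1) n (ComplexShape.down_mk _ _ rfl)
    dsimp only [mapChainComplexMap] at h
    rw [← cancel_mono (T.X₁.leftDerivedObjIso n Y).hom]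
    simp only [Category.assoc, Iso.inv_hom_id, Category.comp_id,
      Functor.leftDerivedObjIso_hom_naturality]
    rw [← Category.assoc, Functor.leftDerivedObjIso_hom_naturality, Iso.inv_hom_id_assoc, h,
      Category.assoc]

lemma δ_app_comp (hT : T.ShortExactOnProjectives) (n : ℕ) (X : C) :
    (hT.δ n).app X ≫ (T.X₁.leftDerivedObjIso n X).hom =
      (T.X₃.leftDerivedObjIso (n + 1) X).hom ≫
        (hT.mapChainComplex (projectiveResolution X)).δ (n + 1) n
          (ComplexShape.down_mk _ _ rfl) := by
  simp [δ]

lemma δ_naturality (hT : T.ShortExactOnProjectives) (hT' : T'.ShortExactOnProjectives)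
    (α : T ⟶ T') (n : ℕ) :
    hT.δ n ≫ NatTrans.leftDerived α.τ₁ n = NatTrans.leftDerived α.τ₃ (n + 1) ≫ hT'.δ n := by
  ext X
  have h := HomologicalComplex.HomologySequence.δ_naturality
    (α.mapChainComplex (projectiveResolution X).complex)
      (hT.mapChainComplex _) (hT'.mapChainComplex _) (n + 1) n (ComplexShape.down_mk _ _ rfl)
  dsimp only [Hom.mapChainComplex] at h
  rw [← cancel_mono (T'.X₁.leftDerivedObjIso n X).hom]
  simp only [NatTrans.comp_app, Category.assoc, δ_app_comp,
    NatTrans.leftDerived_app_comp_leftDerivedObjIso_hom]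
  rw [← Category.assoc, δ_app_comp, Category.assoc, h, ← Category.assoc, ← Category.assoc,
    NatTrans.leftDerived_app_comp_leftDerivedObjIso_hom]

lemma epi_leftDerived_zero (hT : T.ShortExactOnProjectives) (X : C) :
    Epi ((NatTrans.leftDerived T.g 0).app X) := by
  have := (hT.mapChainComplex (projectiveResolution X)).epi_g
  have := HomologicalComplex.epi_homologyMap_of_epi_of_not_rel
    (T.mapChainComplex (projectiveResolution X).complex).g 0 (by simp)
  have := NatTrans.leftDerived_app_comp_leftDerivedObjIso_hom T.g 0 X
  rw [← Iso.eq_comp_inv] at this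
  rw [this]
  infer_instance

lemma exact₂ (hT : T.ShortExactOnProjectives) (n : ℕ) (X : C) :
    (ShortComplex.mk ((NatTrans.leftDerived T.f n).app X)
      ((NatTrans.leftDerived T.g n).app X) (T.leftDerived_f_comp_g n X)).Exact :=
  (ShortComplex.exact_iff_of_iso (ShortComplex.isoMk (T.X₁.leftDerivedObjIso n X)
    (T.X₂.leftDerivedObjIso n X) (T.X₃.leftDerivedObjIso n X)
    (NatTrans.leftDerived_app_comp_leftDerivedObjIso_hom T.f n X).symm
    (NatTrans.leftDerived_app_comp_leftDerivedObjIso_hom T.g n X).symm)).2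
  ((hT.mapChainComplex (projectiveResolution X)).homology_exact₂ n)

lemma leftDerived_g_comp_δ (hT : T.ShortExactOnProjectives) (n : ℕ) (X : C) :
    (NatTrans.leftDerived T.g (n + 1)).app X ≫ (hT.δ n).app X = 0 := by
  rw [← cancel_mono (T.X₁.leftDerivedObjIso n X).hom, Category.assoc,
    δ_app_comp, ← Category.assoc,
    NatTrans.leftDerived_app_comp_leftDerivedObjIso_hom, Category.assoc,
    (hT.mapChainComplex (projectiveResolution X)).comp_δ, comp_zero, zero_comp]

lemma exact₃ (hT : T.ShortExactOnProjectives) (n : ℕ) (X : C) :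
    (ShortComplex.mk ((NatTrans.leftDerived T.g (n + 1)).app X) ((hT.δ n).app X)
      (hT.leftDerived_g_comp_δ n X)).Exact :=
  (ShortComplex.exact_iff_of_iso (ShortComplex.isoMk (T.X₂.leftDerivedObjIso (n + 1) X)
    (T.X₃.leftDerivedObjIso (n + 1) X) (T.X₁.leftDerivedObjIso n X)
    (NatTrans.leftDerived_app_comp_leftDerivedObjIso_hom T.g (n + 1) X).symm
    (hT.δ_app_comp n X).symm)).2
  ((hT.mapChainComplex (projectiveResolution X)).homology_exact₃ (n + 1) n _)

lemma δ_comp_leftDerived_f (hT : T.ShortExactOnProjectives) (n : ℕ) (X : C) :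
    (hT.δ n).app X ≫ (NatTrans.leftDerived T.f n).app X = 0 := by
  rw [← cancel_mono (T.X₂.leftDerivedObjIso n X).hom, Category.assoc,
    NatTrans.leftDerived_app_comp_leftDerivedObjIso_hom, ← Category.assoc,
    δ_app_comp, Category.assoc,
    (hT.mapChainComplex (projectiveResolution X)).δ_comp, comp_zero, zero_comp]

lemma exact₁ (hT : T.ShortExactOnProjectives) (n : ℕ) (X : C) :
    (ShortComplex.mk ((hT.δ n).app X) ((NatTrans.leftDerived T.f n).app X)
      (hT.δ_comp_leftDerived_f n X)).Exact :=
  (ShortComplex.exact_iff_of_iso (ShortComplex.isoMk (T.X₃.leftDerivedObjIso (n + 1) X)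
    (T.X₁.leftDerivedObjIso n X) (T.X₂.leftDerivedObjIso n X)
    (hT.δ_app_comp n X).symm
    (NatTrans.leftDerived_app_comp_leftDerivedObjIso_hom T.f n X).symm)).2
  ((hT.mapChainComplex (projectiveResolution X)).homology_exact₁ (n + 1) n _)

end ShortComplex.ShortExactOnProjectives

end LeftDerived

section FunctorCategory

variable {J A : Type*} [Category* J] [Category* A] [Abelian A]

lemma ShortComplex.exact_of_exact_evaluation (S : ShortComplex (J ⥤ A))
    (hS : ∀ j, (S.map ((evaluation J A).obj j)).Exact) : S.Exact := by
  rw [ShortComplex.exact_iff_isZero_homology, Functor.isZero_iff]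
  intro j
  exact ((ShortComplex.exact_iff_isZero_homology _).1 (hS j)).of_iso
    (S.mapHomologyIso ((evaluation J A).obj j)).symm

end FunctorCategory

section Ext

variable (R : Type*) [Ring R] {C : Type*} [Category* C] [Abelian C] [Linear R C]

/-- The functors `Hom(-, S.X₃)`, `Hom(-, S.X₂)`, `Hom(-, S.X₁)` with values in the opposite
category of modules. -/
def ShortComplex.linearYonedaRightOp (S : ShortComplex C) :
    ShortComplex (C ⥤ (ModuleCat R)ᵒᵖ) where
  X₁ := ((linearYoneda R C).obj S.X₃).rightOp
  X₂ := ((linearYoneda R C).obj S.X₂).rightOp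
  X₃ := ((linearYoneda R C).obj S.X₁).rightOp
  f := NatTrans.rightOp ((linearYoneda R C).map S.g)
  g := NatTrans.rightOp ((linearYoneda R C).map S.f)
  zero := by
    ext X
    apply Quiver.Hom.unop_inj
    ext (x : X ⟶ S.X₁)
    change (x ≫ S.f) ≫ S.g = 0
    simp

instance (S : ShortComplex C) : (S.linearYonedaRightOp R).X₁.Additive :=
  inferInstanceAs ((linearYoneda R C).obj S.X₃).rightOp.Additive

instance (S : ShortComplex C) : (S.linearYonedaRightOp R).X₂.Additive :=
  inferInstanceAs ((linearYoneda R C).obj S.X₂).rightOp.Additive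

instance (S : ShortComplex C) : (S.linearYonedaRightOp R).X₃.Additive :=
  inferInstanceAs ((linearYoneda R C).obj S.X₁).rightOp.Additive

/-- `ShortComplex.linearYonedaRightOp` is contravariantly functorial. -/
def ShortComplex.Hom.linearYonedaRightOp {S S' : ShortComplex C} (φ : S ⟶ S') :
    S'.linearYonedaRightOp R ⟶ S.linearYonedaRightOp R where
  τ₁ := NatTrans.rightOp ((linearYoneda R C).map φ.τ₃)
  τ₂ := NatTrans.rightOp ((linearYoneda R C).map φ.τ₂)
  τ₃ := NatTrans.rightOp ((linearYoneda R C).map φ.τ₁)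
  comm₁₂ := by
    ext X
    apply Quiver.Hom.unop_inj
    ext (x : X ⟶ S.X₂)
    change (x ≫ S.g) ≫ φ.τ₃ = (x ≫ φ.τ₂) ≫ S'.g
    rw [Category.assoc, Category.assoc, φ.comm₂₃]
  comm₂₃ := by
    ext X
    apply Quiver.Hom.unop_inj
    ext (x : X ⟶ S.X₁)
    change (x ≫ S.f) ≫ φ.τ₂ = (x ≫ φ.τ₁) ≫ S'.f
    rw [Category.assoc, Category.assoc, φ.comm₁₂]

namespace ShortComplex.ShortExact

variable {S S' : ShortComplex C}

lemma linearYonedaRightOp (hS : S.ShortExact) :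
    (S.linearYonedaRightOp R).ShortExactOnProjectives := by
  intro X _
  have := hS.mono_f
  have := hS.epi_g
  let T : ShortComplex (ModuleCat R) := ShortComplex.mk
    (((linearYoneda R C).map S.f).app (.op X)) (((linearYoneda R C).map S.g).app (.op X)) (by
      ext (x : X ⟶ S.X₁)
      change (x ≫ S.f) ≫ S.g = 0
      simp)
  have hT : T.ShortExact :=
    { exact := by
        rw [ShortComplex.moduleCat_exact_iff]
        intro (x : X ⟶ S.X₂) (hx : x ≫ S.g = 0)
        exact ⟨hS.exact.lift x hx, hS.exact.lift_f x hx⟩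
      mono_f := by
        rw [ModuleCat.mono_iff_injective]
        intro (x : X ⟶ S.X₁) (y : X ⟶ S.X₁) (h : x ≫ S.f = y ≫ S.f)
        exact (cancel_mono S.f).1 h
      epi_g := by
        rw [ModuleCat.epi_iff_surjective]
        intro (x : X ⟶ S.X₃)
        exact ⟨Projective.factorThru x S.g, Projective.factorThru_comp x S.g⟩ }
  exact ShortComplex.ShortExact.op hT

variable [EnoughProjectives C]

/-- The connecting homomorphism of `Ext` in the second variable. -/
noncomputable def extδ (hS : S.ShortExact) (n : ℕ) :
    (_root_.Ext R C n).flip.obj S.X₃ ⟶ (_root_.Ext R C (n + 1)).flip.obj S.X₁ :=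
  NatTrans.leftOp ((hS.linearYonedaRightOp R).δ n)

lemma extδ_naturality (hS : S.ShortExact) (hS' : S'.ShortExact) (φ : S ⟶ S') (n : ℕ) :
    hS.extδ R n ≫ (_root_.Ext R C (n + 1)).flip.map φ.τ₁ =
      (_root_.Ext R C n).flip.map φ.τ₃ ≫ hS'.extδ R n := by
  have h := ShortExactOnProjectives.δ_naturality (hS'.linearYonedaRightOp R)
    (hS.linearYonedaRightOp R) (φ.linearYonedaRightOp R) n
  exact congr_arg NatTrans.leftOp h.symm

lemma mono_ext_zero (hS : S.ShortExact) : Mono ((_root_.Ext R C 0).flip.map S.f) := by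
  have (X : Cᵒᵖ) : Mono (((_root_.Ext R C 0).flip.map S.f).app X) := by
    have := (hS.linearYonedaRightOp R).epi_leftDerived_zero X.unop
    exact unop_mono_of_epi ((NatTrans.leftDerived (S.linearYonedaRightOp R).g 0).app X.unop)
  exact NatTrans.mono_of_mono_app _

lemma ext_exact₂ (hS : S.ShortExact) (n : ℕ) :
    (ShortComplex.mk ((_root_.Ext R C n).flip.map S.f) ((_root_.Ext R C n).flip.map S.g)
      (by
        ext X : 2
        exact congr_arg Quiver.Hom.unop
          ((S.linearYonedaRightOp R).leftDerived_f_comp_g n X.unop))).Exact :=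
  exact_of_exact_evaluation _ fun X ↦ ((hS.linearYonedaRightOp R).exact₂ n X.unop).unop

lemma ext_exact₃ (hS : S.ShortExact) (n : ℕ) :
    (ShortComplex.mk ((_root_.Ext R C n).flip.map S.g) (hS.extδ R n) (by
        ext X : 2
        exact congr_arg Quiver.Hom.unop
          ((hS.linearYonedaRightOp R).δ_comp_leftDerived_f n X.unop))).Exact :=
  exact_of_exact_evaluation _ fun X ↦ ((hS.linearYonedaRightOp R).exact₁ n X.unop).unop

lemma ext_exact₁ (hS : S.ShortExact) (n : ℕ) :
    (ShortComplex.mk (hS.extδ R n) ((_root_.Ext R C (n + 1)).flip.map S.f) (by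
        ext X : 2
        exact congr_arg Quiver.Hom.unop
          ((hS.linearYonedaRightOp R).leftDerived_g_comp_δ n X.unop))).Exact :=
  exact_of_exact_evaluation _ fun X ↦ ((hS.linearYonedaRightOp R).exact₃ n X.unop).unop

end ShortComplex.ShortExact

end Ext

end CategoryTheory

namespace localCohomology

variable {R : Type u} [CommRing R] (I : Ideal R)

/-- The colimit over the powers of `I` of a functor evaluated at the quotients by these powers. -/
noncomputable def colimPowers :
    ((ModuleCat.{u} R)ᵒᵖ ⥤ ModuleCat.{u} R) ⥤ ModuleCat.{u} R :=
  (Functor.whiskeringLeft _ _ _).obj (ringModIdeals (idealPowersDiagram I)).op ⋙ colim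

instance : PreservesFiniteLimits (colimPowers I) := by
  have := AB5OfSize_of_univLE.{0, 0, u, u} (ModuleCat.{u} R)
  have : PreservesFiniteLimits (colim (J := ℕᵒᵖᵒᵖ) (C := ModuleCat.{u} R)) :=
    HasExactColimitsOfShape.preservesFiniteLimits
  exact comp_preservesFiniteLimits _ _

instance : PreservesFiniteColimits (colimPowers I) := by
  have : PreservesFiniteColimits (colim (J := ℕᵒᵖᵒᵖ) (C := ModuleCat.{u} R)) :=
    colimConstAdj.leftAdjoint_preservesColimits.{0, 0}.preservesFiniteColimits
  exact comp_preservesFiniteColimits _ _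

instance : (colimPowers I).PreservesZeroMorphisms :=
  Functor.preservesZeroMorphisms_of_preserves_terminal_object

/-- Local cohomology as a colimit of modules rather than of functors. -/
noncomputable def isoColimPowers (i : ℕ) :
    localCohomology I i ≅ (Ext R (ModuleCat.{u} R) i).flip ⋙ colimPowers I :=
  NatIso.ofComponents
    (colimitObjIsoColimitCompEvaluation (diagram (idealPowersDiagram I) i))
    (fun f ↦ colimit_map_colimitObjIsoColimitCompEvaluation_hom _ f)

variable {S S' : ShortComplex (ModuleCat.{u} R)}

/-- The connecting homomorphism in local cohomology. -/
noncomputable def δ (hS : S.ShortExact) (i : ℕ) :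
    (localCohomology I i).obj S.X₃ ⟶ (localCohomology I (i + 1)).obj S.X₁ :=
  (isoColimPowers I i).hom.app S.X₃ ≫ (colimPowers I).map (hS.extδ R i) ≫
    (isoColimPowers I (i + 1)).inv.app S.X₁

lemma δ_comp_isoColimPowers_hom (hS : S.ShortExact) (i : ℕ) :
    δ I hS i ≫ (isoColimPowers I (i + 1)).hom.app S.X₁ =
      (isoColimPowers I i).hom.app S.X₃ ≫ (colimPowers I).map (hS.extδ R i) := by
  simp [δ]

lemma δ_naturality (hS : S.ShortExact) (hS' : S'.ShortExact) (φ : S ⟶ S') (i : ℕ) :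
    δ I hS i ≫ (localCohomology I (i + 1)).map φ.τ₁ =
      (localCohomology I i).map φ.τ₃ ≫ δ I hS' i := by
  have h := congr_arg (colimPowers I).map (hS.extδ_naturality R hS' φ i)
  rw [Functor.map_comp, Functor.map_comp] at h
  rw [← Iso.cancel_iso_hom_right _ _ ((isoColimPowers I (i + 1)).app S'.X₁), Iso.app_hom,
    Category.assoc, Category.assoc,
    δ_comp_isoColimPowers_hom, NatTrans.naturality, NatTrans.naturality_assoc, ← Category.assoc,
    δ_comp_isoColimPowers_hom, Category.assoc]
  exact congr_arg _ h

lemma mono_map_zero (hS : S.ShortExact) : Mono ((localCohomology I 0).map S.f) := by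
  have := hS.mono_ext_zero R
  have : Mono (((Ext R (ModuleCat.{u} R) 0).flip ⋙ colimPowers I).map S.f) :=
    preserves_mono_of_preservesLimit (colimPowers I) ((Ext R (ModuleCat.{u} R) 0).flip.map S.f)
  have h := (isoColimPowers I 0).hom.naturality S.f
  rw [← Iso.app_hom, ← Iso.app_hom, ← Iso.eq_comp_inv, Category.assoc] at h
  rw [h]
  have := mono_comp (((Ext R (ModuleCat.{u} R) 0).flip ⋙ colimPowers I).map S.f)
    ((isoColimPowers I 0).app S.X₂).inv
  exact mono_comp ((isoColimPowers I 0).app S.X₁).hom _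

lemma exact_of_iso_map_colimPowers {T : ShortComplex ((ModuleCat.{u} R)ᵒᵖ ⥤ ModuleCat.{u} R)}
    (hT : T.Exact) {A B C : ModuleCat.{u} R} {f : A ⟶ B} {g : B ⟶ C}
    (e₁ : A ≅ (colimPowers I).obj T.X₁) (e₂ : B ≅ (colimPowers I).obj T.X₂)
    (e₃ : C ≅ (colimPowers I).obj T.X₃)
    (hf : f ≫ e₂.hom = e₁.hom ≫ (colimPowers I).map T.f)
    (hg : g ≫ e₃.hom = e₂.hom ≫ (colimPowers I).map T.g) :
    Function.Exact f g := by
  have w : f ≫ g = 0 := by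
    rw [← cancel_mono e₃.hom, Category.assoc, hg, reassoc_of% hf, ← Functor.map_comp, T.zero,
      Functor.map_zero, comp_zero, zero_comp]
  refine (ShortComplex.ShortExact.moduleCat_exact_iff_function_exact
    (ShortComplex.mk f g w)).1 ?_
  exact (ShortComplex.exact_iff_of_iso
    (ShortComplex.isoMk (S₂ := T.map (colimPowers I)) e₁ e₂ e₃ hf.symm hg.symm)).2
    (hT.map (colimPowers I))

lemma exact_map_map (hS : S.ShortExact) (i : ℕ) :
    Function.Exact ((localCohomology I i).map S.f) ((localCohomology I i).map S.g) :=
  exact_of_iso_map_colimPowers I (hS.ext_exact₂ R i) ((isoColimPowers I i).app _)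
    ((isoColimPowers I i).app _) ((isoColimPowers I i).app _)
    ((isoColimPowers I i).hom.naturality _) ((isoColimPowers I i).hom.naturality _)

lemma exact_map_δ (hS : S.ShortExact) (i : ℕ) :
    Function.Exact ((localCohomology I i).map S.g) (δ I hS i) :=
  exact_of_iso_map_colimPowers I (hS.ext_exact₃ R i) ((isoColimPowers I i).app _)
    ((isoColimPowers I i).app _) ((isoColimPowers I (i + 1)).app _)
    ((isoColimPowers I i).hom.naturality _) (δ_comp_isoColimPowers_hom I hS i)

lemma exact_δ_map (hS : S.ShortExact) (i : ℕ) :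
    Function.Exact (δ I hS i) ((localCohomology I (i + 1)).map S.f) :=
  exact_of_iso_map_colimPowers I (hS.ext_exact₁ R i) ((isoColimPowers I i).app _)
    ((isoColimPowers I (i + 1)).app _) ((isoColimPowers I (i + 1)).app _)
    (δ_comp_isoColimPowers_hom I hS i) ((isoColimPowers I (i + 1)).hom.naturality _)

end localCohomology

lemma ModuleCat.exists_shortExact {R : Type u} [CommRing R] {A B C : ModuleCat.{u} R}
    {f : A ⟶ B} {g : B ⟶ C} (hf : Function.Injective f) (hg : Function.Surjective g)
    (hfg : Function.Exact f g) : ∃ w : f ≫ g = 0, (ShortComplex.mk f g w).ShortExact := by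
  have w : f ≫ g = 0 := by
    ext x
    exact hfg.apply_apply_eq_zero x
  exact ⟨w,
    { exact := (ShortComplex.ShortExact.moduleCat_exact_iff_function_exact _).2 hfg
      mono_f := (ModuleCat.mono_iff_injective _).2 hf
      epi_g := (ModuleCat.epi_iff_surjective _).2 hg }⟩

end

theorem stmt4 {R : Type u} [CommRing R] (I : Ideal R) :
    ∃ δ : ∀ (M' M M'' : ModuleCat.{u} R) (_ : M' ⟶ M) (g : M ⟶ M'') (i : ℕ),
        (localCohomology I i).obj M'' ⟶ (localCohomology I (i + 1)).obj M',
      (∀ (M' M M'' : ModuleCat.{u} R) (f : M' ⟶ M) (g : M ⟶ M''),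
        Function.Injective f → Function.Surjective g → Function.Exact f g →
          (Function.Injective ((localCohomology I 0).map f) ∧
          (∀ i : ℕ, Function.Exact ((localCohomology I i).map f) ((localCohomology I i).map g)) ∧
          (∀ i : ℕ, Function.Exact ((localCohomology I i).map g) (δ M' M M'' f g i)) ∧
          (∀ i : ℕ, Function.Exact (δ M' M M'' f g i) ((localCohomology I (i + 1)).map f)))) ∧
      (∀ (M' M M'' N' N N'' : ModuleCat.{u} R) (f : M' ⟶ M) (g : M ⟶ M'')
          (f' : N' ⟶ N) (g' : N ⟶ N'') (a : M' ⟶ N') (b : M ⟶ N) (c : M'' ⟶ N''),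
        Function.Injective f → Function.Surjective g → Function.Exact f g →
        Function.Injective f' → Function.Surjective g' → Function.Exact f' g' →
        f ≫ b = a ≫ f' → g ≫ c = b ≫ g' →
          ∀ i : ℕ, δ M' M M'' f g i ≫ (localCohomology I (i + 1)).map a =
            (localCohomology I i).map c ≫ δ N' N N'' f' g' i) := by
  classical
  refine ⟨fun M' M M'' f g i ↦ if h : ∃ w : f ≫ g = 0, (ShortComplex.mk f g w).ShortExact
    then localCohomology.δ I h.2 i else 0, ?_, ?_⟩
  · intro M' M M'' f g hf hg hfg
    have h := ModuleCat.exists_shortExact hf hg hfg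
    simp only [dif_pos h]
    exact ⟨(ModuleCat.mono_iff_injective _).1 (localCohomology.mono_map_zero I h.2),
      localCohomology.exact_map_map I h.2, localCohomology.exact_map_δ I h.2,
      localCohomology.exact_δ_map I h.2⟩
  · intro M' M M'' N' N N'' f g f' g' a b c hf hg hfg hf' hg' hfg' hab hbc i
    have h := ModuleCat.exists_shortExact hf hg hfg
    have h' := ModuleCat.exists_shortExact hf' hg' hfg'
    simp only [dif_pos h, dif_pos h']
    exact localCohomology.δ_naturality I h.2 h'.2 ⟨a, b, c, hab.symm, hbc.symm⟩ i
end

section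
/- Let R be a commutative ring and let α_0, …, α_n be a regular sequence on R such that each α_i is a non-zero-divisor of R; let I = (α_0, …, α_n). Then for every R-module M and every i > n + 1, the local cohomology H_I^i(M) vanishes. -/
open CategoryTheory

universe u

namespace RingTheory.Sequence

section

variable {R M M₁ M₂ M₃ : Type*} [CommRing R] [AddCommGroup M] [Module R M]
  [AddCommGroup M₁] [Module R M₁] [AddCommGroup M₂] [Module R M₂] [AddCommGroup M₃] [Module R M₃]

/-- Every sequence is weakly regular on the zero module. -/
lemma IsWeaklyRegular.of_subsingleton [Subsingleton M] (rs : List R) : IsWeaklyRegular M rs :=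
  (isWeaklyRegular_iff_Fin M rs).mpr fun _ _ _ _ ↦ Subsingleton.elim _ _

/-- Weakly regular sequences are stable under extensions of modules. -/
lemma IsWeaklyRegular.of_exact {f : M₁ →ₗ[R] M₂} {g : M₂ →ₗ[R] M₃}
    (hf : Function.Injective f) (hfg : Function.Exact f g) (hg : Function.Surjective g)
    {rs : List R} (h₁ : IsWeaklyRegular M₁ rs) (h₃ : IsWeaklyRegular M₃ rs) :
    IsWeaklyRegular M₂ rs := by
  induction rs generalizing M₁ M₂ M₃ with
  | nil => exact .nil R M₂
  | cons r rs ih =>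
    rw [isWeaklyRegular_cons_iff] at h₁ h₃
    have h₀ : Function.Exact (0 : M₁ →ₗ[R] M₁) f :=
      (LinearMap.exact_zero_iff_injective M₁ f).mpr hf
    have hinj : Function.Injective (QuotSMulTop.map r f) := by
      have h := QuotSMulTop.map_first_exact_on_four_term_exact_of_isSMulRegular_last h₀ hfg h₃.1
      rw [map_zero] at h
      exact (LinearMap.exact_zero_iff_injective _ _).mp h
    exact .cons (isSMulRegular_of_range_eq_ker hf hfg.linearMap_ker_eq.symm h₁.1 h₃.1)
      (ih hinj (QuotSMulTop.map_exact r hfg hg) (QuotSMulTop.map_surjective r hg) h₁.2 h₃.2)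

/-- If `a, r₁, …, rₙ` and `b, r₁, …, rₙ` are weakly regular on `M`, then so is
`a * b, r₁, …, rₙ`. -/
lemma IsWeaklyRegular.mul_cons {a b : R} {rs : List R} (ha : IsWeaklyRegular M (a :: rs))
    (hb : IsWeaklyRegular M (b :: rs)) : IsWeaklyRegular M ((a * b) :: rs) := by
  rw [isWeaklyRegular_cons_iff] at ha hb
  refine .cons (ha.1.mul hb.1) ?_
  let f : QuotSMulTop b M →ₗ[R] QuotSMulTop (a * b) M :=
    Submodule.mapQ _ _ (LinearMap.lsmul R M a) fun x hx ↦ by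
      obtain ⟨y, -, rfl⟩ := (Submodule.mem_smul_pointwise_iff_exists _ _ _).mp hx
      exact (Submodule.mem_smul_pointwise_iff_exists _ _ _).mpr ⟨y, trivial, mul_smul a b y⟩
  let g : QuotSMulTop (a * b) M →ₗ[R] QuotSMulTop a M :=
    Submodule.mapQ _ _ LinearMap.id fun x hx ↦ by
      obtain ⟨y, -, rfl⟩ := (Submodule.mem_smul_pointwise_iff_exists _ _ _).mp hx
      exact (Submodule.mem_smul_pointwise_iff_exists _ _ _).mpr
        ⟨b • y, trivial, by simp [mul_smul]⟩
  refine .of_exact (f := f) (g := g) ?_ ?_ ?_ hb.2 ha.2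
  · rw [injective_iff_map_eq_zero]
    intro x hx
    obtain ⟨x, rfl⟩ := Submodule.mkQ_surjective _ x
    obtain ⟨y, -, hy⟩ := (Submodule.mem_smul_pointwise_iff_exists _ _ _).mp
      ((Submodule.Quotient.mk_eq_zero _).mp hx)
    refine (Submodule.Quotient.mk_eq_zero _).mpr
      ((Submodule.mem_smul_pointwise_iff_exists _ _ _).mpr ⟨y, trivial, ha.1 ?_⟩)
    simpa [mul_smul] using hy
  · intro x
    obtain ⟨x, rfl⟩ := Submodule.mkQ_surjective _ x
    constructor
    · intro hx
      obtain ⟨y, -, rfl⟩ := (Submodule.mem_smul_pointwise_iff_exists _ _ _).mp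
        ((Submodule.Quotient.mk_eq_zero _).mp hx)
      exact ⟨Submodule.mkQ _ y, rfl⟩
    · rintro ⟨y, hy⟩
      obtain ⟨y, rfl⟩ := Submodule.mkQ_surjective _ y
      rw [← hy]
      exact (Submodule.Quotient.mk_eq_zero _).mpr
        ((Submodule.mem_smul_pointwise_iff_exists _ _ _).mpr ⟨y, trivial, rfl⟩)
  · intro x
    obtain ⟨x, rfl⟩ := Submodule.mkQ_surjective _ x
    exact ⟨Submodule.mkQ _ x, rfl⟩

open scoped Pointwise in
lemma IsWeaklyRegular.pow_cons {a : R} {rs : List R} (h : IsWeaklyRegular M (a :: rs)) (t : ℕ) :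
    IsWeaklyRegular M ((a ^ t) :: rs) := by
  induction t with
  | zero =>
    have : Subsingleton (QuotSMulTop (1 : R) M) :=
      Submodule.Quotient.subsingleton_iff.mpr (one_smul R _)
    rw [pow_zero]
    exact .cons (.one M) (.of_subsingleton rs)
  | succ t ih => exact pow_succ a t ▸ ih.mul_cons h

/-- Raising the members of a weakly regular sequence to a power preserves weak regularity. -/
lemma IsWeaklyRegular.map_pow {rs : List R} (h : IsWeaklyRegular M rs) (t : ℕ) :
    IsWeaklyRegular M (rs.map (· ^ t)) := by
  induction rs generalizing M with
  | nil => exact h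
  | cons a rs ih =>
    have h' := (isWeaklyRegular_cons_iff _ _ _).mp (h.pow_cons t)
    exact .cons h'.1 (ih h'.2)

end

/-- The quotient of `M` by a weakly regular sequence of length `n` has projective dimension at
most `n` more than that of `M`. -/
lemma IsWeaklyRegular.hasProjectiveDimensionLT_quotient {R : Type u} [CommRing R]
    {M : Type u} [AddCommGroup M] [Module R M] {rs : List R} (h : IsWeaklyRegular M rs) (k : ℕ)
    [HasProjectiveDimensionLT (ModuleCat.of R M) k] :
    HasProjectiveDimensionLT
      (ModuleCat.of R (M ⧸ (Ideal.ofList rs • ⊤ : Submodule R M))) (k + rs.length) := by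
  induction rs generalizing M k with
  | nil =>
    rw [List.length_nil, add_zero]
    exact hasProjectiveDimensionLT_of_iso (Submodule.quotEquivOfEqBot _
      ((congrArg (· • ⊤) Ideal.ofList_nil).trans (Submodule.bot_smul ⊤))).symm.toModuleIso k
  | cons r rs ih =>
    rw [isWeaklyRegular_cons_iff] at h
    have : HasProjectiveDimensionLT (ModuleCat.of R (QuotSMulTop r M)) (k + 1) :=
      (IsSMulRegular.smulShortComplex_shortExact (M := ModuleCat.of R M)
        h.1).hasProjectiveDimensionLT_X₃ k ‹_›
          (hasProjectiveDimensionLT_of_ge (ModuleCat.of R M) k (k + 1) k.le_succ)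
    have := ih h.2 (k + 1)
    rw [List.length_cons, add_comm rs.length, ← add_assoc]
    exact hasProjectiveDimensionLT_of_iso
      (Submodule.quotOfListConsSMulTopEquivQuotSMulTopInner M r rs).symm.toModuleIso _

lemma IsWeaklyRegular.hasProjectiveDimensionLT {R : Type u} [CommRing R] {rs : List R}
    (h : IsWeaklyRegular R rs) :
    HasProjectiveDimensionLT (ModuleCat.of R (R ⧸ Ideal.ofList rs)) (rs.length + 1) := by
  have : Projective (ModuleCat.of R R) :=
    (IsProjective.iff_projective R).mp inferInstance
  have : HasProjectiveDimensionLT (ModuleCat.of R R) 1 := inferInstance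
  have := h.hasProjectiveDimensionLT_quotient 1
  rw [add_comm]
  exact hasProjectiveDimensionLT_of_iso (Submodule.quotEquivOfEq
    (Ideal.ofList rs • ⊤) (Ideal.ofList rs) (Ideal.mul_top _)).toModuleIso _

end RingTheory.Sequence

/-- The `Ext` groups defined through left derived functors vanish above the projective
dimension. -/
lemma CategoryTheory.isZero_Ext_of_hasProjectiveDimensionLT {R : Type u} [CommRing R]
    (X Y : ModuleCat.{u} R) (n : ℕ) [HasProjectiveDimensionLT X n] {i : ℕ} (hi : n ≤ i)
    (hi₀ : i ≠ 0) :
    Limits.IsZero (((Ext R (ModuleCat.{u} R) i).obj (Opposite.op X)).obj Y) := by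
  obtain ⟨p, rfl⟩ := Nat.exists_eq_succ_of_ne_zero hi₀
  let P := projectiveResolution X
  refine .of_iso ?_ (P.isoExt (p + 1) Y)
  rw [← HomologicalComplex.exactAt_iff_isZero_homology,
    HomologicalComplex.exactAt_iff' _ p (p + 1) (p + 2) (by simp) (by simp),
    ShortComplex.moduleCat_exact_iff]
  intro (f : P.complex.X (p + 1) ⟶ Y) hf
  have hf' : P.complex.d (p + 2) (p + 1) ≫ f = 0 := hf
  obtain ⟨g, hg⟩ := (P.extMk_eq_zero_iff f (p + 2) rfl hf' p rfl).mp
    (Abelian.Ext.eq_zero_of_hasProjectiveDimensionLT _ n hi)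
  exact ⟨g, hg⟩

/-- A colimit vanishes if every object of the diagram has a vanishing map to a later object. -/
lemma CategoryTheory.Limits.isZero_colimit_of_exists_map_eq_zero {J C : Type*} [Category* J]
    [Category* C] [HasZeroMorphisms C] (F : J ⥤ C) [HasColimit F]
    (h : ∀ j, ∃ (k : J) (f : j ⟶ k), F.map f = 0) : IsZero (colimit F) := by
  rw [IsZero.iff_id_eq_zero]
  refine colimit.hom_ext fun j ↦ ?_
  obtain ⟨k, f, hf⟩ := h j
  rw [Category.comp_id, comp_zero, ← colimit.w F f, hf, zero_comp]

/-- The local cohomology of an ideal vanishes in degree `i` if between any two sufficiently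
distant powers of the ideal there is an ideal `J` such that `R ⧸ J` has projective dimension
less than `i`. -/
lemma localCohomology.isZero_of_forall_exists {R : Type u} [CommRing R] (I : Ideal R) {i : ℕ}
    (hi : i ≠ 0) (h : ∀ t : ℕ, ∃ (J : Ideal R) (s : ℕ), J ≤ I ^ t ∧ I ^ s ≤ J ∧ t ≤ s ∧
      HasProjectiveDimensionLT (ModuleCat.of R (R ⧸ J)) i) :
    Limits.IsZero (localCohomology I i) := by
  have := hasColimitDiagram.{u, 0} (idealPowersDiagram I) i
  refine Limits.isZero_colimit_of_exists_map_eq_zero (diagram (idealPowersDiagram I) i) ?_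
  intro t
  obtain ⟨J, s, hJt, hsJ, hts, hJ⟩ := h t.unop.unop
  let f : t ⟶ Opposite.op (Opposite.op s) := (homOfLE hts).op.op
  refine ⟨_, f, ?_⟩
  let a : ModuleCat.of R (R ⧸ I ^ s) ⟶ ModuleCat.of R (R ⧸ J) :=
    ModuleCat.ofHom (Submodule.mapQ _ _ LinearMap.id hsJ)
  let b : ModuleCat.of R (R ⧸ J) ⟶ ModuleCat.of R (R ⧸ I ^ t.unop.unop) :=
    ModuleCat.ofHom (Submodule.mapQ _ _ LinearMap.id hJt)
  have hab : (ringModIdeals (idealPowersDiagram I)).map f.unop = a ≫ b := by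
    refine ModuleCat.hom_ext (Submodule.quot_hom_ext _ _ _ fun _ ↦ rfl)
  have hmap : (diagram (idealPowersDiagram I) i).map f =
      (Ext R (ModuleCat.{u} R) i).map b.op ≫ (Ext R (ModuleCat.{u} R) i).map a.op := by
    rw [← Functor.map_comp, ← op_comp, ← hab]
    rfl
  have hzero : Limits.IsZero ((Ext R (ModuleCat.{u} R) i).obj
      (Opposite.op (ModuleCat.of R (R ⧸ J)))) :=
    (Functor.isZero_iff _).mpr fun Y ↦ isZero_Ext_of_hasProjectiveDimensionLT _ Y i le_rfl hi
  rw [hmap, hzero.eq_zero_of_tgt ((Ext R (ModuleCat.{u} R) i).map b.op), Limits.zero_comp]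
  rfl

theorem stmt5 {R : Type u} [CommRing R] (n : ℕ) (α : Fin (n + 1) → R)
    (hreg : RingTheory.Sequence.IsWeaklyRegular R (List.ofFn α))
    (hnzd : ∀ i, α i ∈ nonZeroDivisors R)
    (M : Type u) [AddCommGroup M] [Module R M] (i : ℕ) (hi : n + 1 < i) :
    Subsingleton ((localCohomology (Ideal.span (Set.range α)) i).obj (ModuleCat.of R M)) := by
  have hzero : Limits.IsZero (localCohomology (Ideal.span (Set.range α)) i) := by
    refine localCohomology.isZero_of_forall_exists _ (by lia) fun t ↦ ?_
    let J := Ideal.ofList ((List.ofFn α).map (· ^ t))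
    have hrad : Ideal.span (Set.range α) ≤ J.radical := by
      rw [Ideal.span_le]
      rintro _ ⟨j, rfl⟩
      exact ⟨t, Ideal.subset_span (List.mem_map.mpr ⟨α j, (List.mem_ofFn' α _).mpr ⟨j, rfl⟩, rfl⟩)⟩
    obtain ⟨s, hs⟩ := Ideal.exists_pow_le_of_le_radical_of_fg hrad
      (Submodule.fg_span (Set.finite_range α))
    refine ⟨J, s + t, ?_, (Ideal.pow_le_pow_right (Nat.le_add_right s t)).trans hs,
      Nat.le_add_left t s, ?_⟩
    · refine Ideal.span_le.mpr fun x (hx : x ∈ (List.ofFn α).map (· ^ t)) ↦ ?_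
      obtain ⟨y, hy, rfl⟩ := List.mem_map.mp hx
      obtain ⟨j, rfl⟩ := (List.mem_ofFn' α y).mp hy
      exact Ideal.pow_mem_pow (Ideal.subset_span (Set.mem_range_self j)) t
    · have := (hreg.map_pow t).hasProjectiveDimensionLT
      rw [List.length_map, List.length_ofFn] at this
      exact hasProjectiveDimensionLT_of_ge _ (n + 1 + 1) i hi
  exact ModuleCat.subsingleton_of_isZero ((Functor.isZero_iff _).mp hzero _)
end

section
/- Let R be a commutative ring, I an ideal of R, and M an R-module. Suppose there exist elements a, b ∈ I such that a is a non-zero-divisor on M and b is a non-zero-divisor on M/aM (i.e., (a, b) is a regular sequence on M). Then Ext_R^1(R/I, M) = 0; equivalently, every short exact sequence of R-modules 0 → M → X → R/I → 0 splits. -/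
open CategoryTheory

universe u

/-- Let `(a, b)` be a regular sequence on `M`, and let `d : K → N` be a linear map whose cokernel is
killed by `a` and `b`. Every linear map `c : K → M` that vanishes on the kernel of `d` factors
through `d`. -/
theorem exists_comp_eq_of_regular_pair {R : Type*} [CommRing R] {M K N : Type*}
    [AddCommGroup M] [Module R M] [AddCommGroup K] [Module R K] [AddCommGroup N] [Module R N]
    {a b : R} (hareg : Function.Injective (fun m : M => a • m))
    (hbreg : Function.Injective
      (fun m : M ⧸ (Submodule.span R {a} • (⊤ : Submodule R M)) => b • m))
    (d : K →ₗ[R] N) (c : K →ₗ[R] M) (hker : ∀ x, d x = 0 → c x = 0)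
    (hd : ∀ n, a • n ∈ LinearMap.range d ∧ b • n ∈ LinearMap.range d) :
    ∃ H : N →ₗ[R] M, H ∘ₗ d = c := by
  have hwd : ∀ x y, d x = d y → c x = c y := fun x y h => by
    rw [← sub_eq_zero, ← map_sub]
    exact hker _ (by rw [map_sub, h, sub_self])
  have hex : ∀ n, ∃ m, ∀ x, d x = a • n → c x = a • m := by
    intro n
    obtain ⟨⟨p, hp⟩, q, hq⟩ := hd n
    have hpq : b • c p = a • c q := by
      rw [← map_smul, ← map_smul]
      exact hwd _ _ (by rw [map_smul, map_smul, hp, hq, smul_comm])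
    have hmem : c p ∈ Submodule.span R {a} • (⊤ : Submodule R M) := by
      rw [← Submodule.Quotient.mk_eq_zero]
      apply hbreg
      simp only [smul_zero]
      rw [← Submodule.Quotient.mk_smul, Submodule.Quotient.mk_eq_zero, hpq]
      exact Submodule.smul_mem_smul (Submodule.mem_span_singleton_self a) trivial
    obtain ⟨m, -, hm⟩ := Submodule.mem_smul_pointwise_iff_exists _ _ _ |>.1
      (Submodule.ideal_span_singleton_smul a (⊤ : Submodule R M) ▸ hmem)
    exact ⟨m, fun x hx => by rw [hwd x p (hx.trans hp.symm), hm]⟩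
  choose H hH using hex
  have key : ∀ n m x, d x = a • n → c x = a • m → H n = m := fun n m x hx hc =>
    hareg ((hH n x hx).symm.trans hc)
  refine ⟨{ toFun := H, map_add' := fun n n' => ?_, map_smul' := fun r n => ?_ }, ?_⟩
  · obtain ⟨⟨p, hp⟩, -⟩ := hd n
    obtain ⟨⟨p', hp'⟩, -⟩ := hd n'
    exact key _ _ (p + p') (by rw [map_add, hp, hp', smul_add])
      (by rw [map_add, hH n p hp, hH n' p' hp', smul_add])
  · obtain ⟨⟨p, hp⟩, -⟩ := hd n
    exact key _ _ (r • p) (by rw [map_smul, hp, smul_comm])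
      (by rw [map_smul, hH n p hp, smul_comm, RingHom.id_apply])
  · ext x
    exact key _ _ (a • x) (map_smul d a x) (map_smul c a x)

theorem stmt11 {R : Type u} [CommRing R] (I : Ideal R) (M : Type u) [AddCommGroup M]
    [Module R M] (a b : R) (ha : a ∈ I) (hb : b ∈ I)
    (hareg : Function.Injective (fun m : M => a • m))
    (hbreg : Function.Injective
      (fun m : M ⧸ (Submodule.span R {a} • (⊤ : Submodule R M)) => b • m)) :
    Subsingleton (((Ext R (ModuleCat.{u} R) 1).obj
        (Opposite.op (ModuleCat.of R (R ⧸ I)))).obj (ModuleCat.of R M)) ∧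
    (∀ (X : Type u) [AddCommGroup X] [Module R X] (f : M →ₗ[R] X)
        (g : X →ₗ[R] R ⧸ I), Function.Injective f → Function.Surjective g →
        Function.Exact f g → ∃ s : (R ⧸ I) →ₗ[R] X, g ∘ₗ s = LinearMap.id) := by
  have hI : ∀ r ∈ I, ∀ y : R ⧸ I, r • y = 0 := by
    intro r hr y
    obtain ⟨s, rfl⟩ := Ideal.Quotient.mk_surjective y
    rw [← Ideal.Quotient.mk_eq_mk, ← Submodule.Quotient.mk_smul, Submodule.Quotient.mk_eq_zero]
    exact I.mul_mem_right s hr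
  refine ⟨?_, fun X _ _ f g hf hg hfg => ?_⟩
  · let P := projectiveResolution (ModuleCat.of R (R ⧸ I))
    refine ModuleCat.subsingleton_of_isZero (.of_iso ?_ (P.isoExt (R := R) 1 (ModuleCat.of R M)))
    rw [← HomologicalComplex.exactAt_iff_isZero_homology,
      HomologicalComplex.exactAt_iff' _ 0 1 2 (by simp) (by simp),
      ShortComplex.moduleCat_exact_iff]
    intro (c : P.complex.X 1 ⟶ ModuleCat.of R M) hc
    replace hc : P.complex.d 2 1 ≫ c = 0 := hc
    have h1 := (ShortComplex.moduleCat_exact_iff _).1 (P.exact_succ 0)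
    have h0 := (ShortComplex.moduleCat_exact_iff _).1 P.exact₀
    have hr : ∀ r ∈ I, ∀ n : P.complex.X 0, r • n ∈ LinearMap.range (P.complex.d 1 0).hom :=
      fun r hr n => h0 (r • n) ((map_smul (P.π.f 0).hom r n).trans (hI r hr _))
    obtain ⟨H, hH⟩ := exists_comp_eq_of_regular_pair hareg hbreg (P.complex.d 1 0).hom c.hom
      (fun x hx => by
        obtain ⟨y, rfl⟩ := h1 x hx
        exact ConcreteCategory.congr_hom hc y)
      (fun n => ⟨hr a ha n, hr b hb n⟩)
    exact ⟨ModuleCat.ofHom H, ModuleCat.hom_ext hH⟩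
  · have hr : ∀ r ∈ I, ∀ x, r • x ∈ LinearMap.range f := fun r hr x =>
      (hfg _).1 (by rw [map_smul, hI r hr])
    obtain ⟨H, hH⟩ := exists_comp_eq_of_regular_pair hareg hbreg f LinearMap.id
      (fun x hx => hf (hx.trans (map_zero f).symm)) (fun x => ⟨hr a ha x, hr b hb x⟩)
    exact ((hfg.split_tfae hf hg).out 0 1 :
      (∃ s, g ∘ₗ s = LinearMap.id) ↔ ∃ l, l ∘ₗ f = LinearMap.id).2 ⟨H, hH⟩
end

section
/- Let R be a commutative ring, I an ideal of R, and M an R-module such that multiplication by some element a ∈ I is bijective on M. Then H_I^i(M) = 0 for all i ≥ 0. -/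
open CategoryTheory Limits

universe u

/-- The action of `a` on `Ext n (X, Y)` through `X` agrees with its action through `Y`. -/
lemma Ext_map_smul_id_app {R : Type*} [CommRing R] {C : Type*} [Category* C] [Abelian C]
    [Linear R C] [EnoughProjectives C] (n : ℕ) (X Y : C) (a : R) :
    ((Ext R C n).map (a • 𝟙 X).op).app Y =
      ((Ext R C n).obj (Opposite.op X)).map (a • 𝟙 Y) := by
  let P := projectiveResolution X
  have hcentral {Z W : C} (f : Z ⟶ W) : (a • 𝟙 Z) ≫ f = f ≫ (a • 𝟙 W) := by simp
  have hcomm : (a • 𝟙 P.complex) ≫ P.π = P.π ≫ (ChainComplex.single₀ C).map (a • 𝟙 X) := by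
    ext
    rw [HomologicalComplex.comp_f, HomologicalComplex.comp_f, ChainComplex.single₀_map_f_zero]
    exact hcentral (P.π.f 0)
  have h₁ := Functor.leftDerived_map_eq ((linearYoneda R C).obj Y).rightOp n (a • 𝟙 X)
    (a • 𝟙 P.complex) hcomm
  have h₂ := P.leftDerived_app_eq (NatTrans.rightOp ((linearYoneda R C).map (a • 𝟙 Y))) n
  refine Quiver.Hom.op_inj ?_
  refine h₁.trans (Eq.trans ?_ h₂.symm)
  congr 2
  change (HomologicalComplex.homologyFunctor _ _ n).map _ = _
  congr 1
  ext i : 1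
  refine Quiver.Hom.unop_inj ?_
  ext f
  exact hcentral f

/-- `Ext n (X, Y)` vanishes if `a` acts as zero on `X` and invertibly on `Y`. -/
lemma isZero_Ext_of_smul_id_eq_zero {R : Type*} [CommRing R] {C : Type*} [Category* C]
    [Abelian C] [Linear R C] [EnoughProjectives C] (n : ℕ) (X Y : C) (a : R)
    (hX : a • 𝟙 X = 0) [IsIso (a • 𝟙 Y)] :
    IsZero (((Ext R C n).obj (Opposite.op X)).obj Y) := by
  have hzero : ((Ext R C n).map (a • 𝟙 X).op).app Y = 0 := by
    have hder : (((linearYoneda R C).obj Y).rightOp.leftDerived n).map (0 : X ⟶ X) = 0 :=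
      (Functor.leftDerived_map_eq _ n (P := projectiveResolution X)
        (Q := projectiveResolution X) 0 0 (by simp)).trans (by simp; exact zero_comp)
    rw [hX]
    exact congrArg Quiver.Hom.unop hder
  have : IsIso (((Ext R C n).obj (Opposite.op X)).map (a • 𝟙 Y)) := inferInstance
  rw [← Ext_map_smul_id_app, hzero] at this
  exact (IsZero.iff_id_eq_zero _).2 (isIsoZeroEquiv _ _ this).1

theorem stmt12 {R : Type u} [CommRing R] (I : Ideal R) (M : Type u) [AddCommGroup M]
    [Module R M] (a : R) (ha : a ∈ I) (hbij : Function.Bijective (fun m : M => a • m)) (i : ℕ) :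
    Subsingleton ((localCohomology I i).obj (ModuleCat.of R M)) := by
  have hExt (j : ℕᵒᵖᵒᵖ) : IsZero
      (((localCohomology.diagram (localCohomology.idealPowersDiagram I) i).obj j).obj
        (ModuleCat.of R M)) := by
    have hiso : IsIso (a ^ j.unop.unop • 𝟙 (ModuleCat.of R M)) := by
      rw [ConcreteCategory.isIso_iff_bijective]
      convert hbij.iterate j.unop.unop using 1
      ext m
      simp [smul_iterate]
    refine isZero_Ext_of_smul_id_eq_zero i _ _ (a ^ j.unop.unop) ?_
    ext x
    obtain ⟨r, rfl⟩ := Ideal.Quotient.mk_surjective x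
    exact Ideal.Quotient.eq_zero_iff_mem (a := a ^ j.unop.unop * r).mpr
      (Ideal.mul_mem_right _ _ (Ideal.pow_mem_pow ha _))
  refine ModuleCat.subsingleton_of_isZero ?_
  have := localCohomology.hasColimitDiagram.{u, 0} (localCohomology.idealPowersDiagram I) i
  rw [IsZero.iff_id_eq_zero]
  refine (isColimitOfPreserves ((evaluation _ _).obj (ModuleCat.of R M))
    (colimit.isColimit
      (localCohomology.diagram (localCohomology.idealPowersDiagram I) i))).hom_ext fun j => ?_
  exact (hExt j).eq_of_src _ _
end

section
/- Let R be a commutative ring and let α_0, …, α_n (n ≥ 1) be a regular sequence on R such that each α_i is a non-zero-divisor of R; let I = (α_0, …, α_n). Suppose M is an R-module such that for each 0 ≤ j ≤ n−1 every element of M is annihilated by some power of α_j. Then H_I^0(M) is isomorphic to the submodule of M of elements annihilated by some power of α_n, H_I^1(M) is isomorphic to the cokernel of the localization map M → M[1/α_n], and H_I^i(M) = 0 for all i ≥ 2. -/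
open CategoryTheory

universe u

/-- The submodule of elements of `M` annihilated by some power of `a`. -/
def powersTorsionBy {R : Type u} [CommRing R] (a : R) (M : Type u) [AddCommGroup M]
    [Module R M] : Submodule R M where
  carrier := {m | ∃ t : ℕ, a ^ t • m = 0}
  zero_mem' := ⟨0, smul_zero _⟩
  add_mem' := by
    rintro x y ⟨s, hs⟩ ⟨t, ht⟩
    refine ⟨s + t, ?_⟩
    have hx : (a ^ s * a ^ t) • x = 0 := by rw [mul_comm, mul_smul, hs, smul_zero]
    have hy : (a ^ s * a ^ t) • y = 0 := by rw [mul_smul, ht, smul_zero]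
    rw [smul_add, pow_add, hx, hy, add_zero]
  smul_mem' := by
    rintro c m ⟨t, ht⟩
    exact ⟨t, by rw [smul_comm, ht, smul_zero]⟩

namespace CategoryTheory.ProjectiveResolution
open HomologicalComplex Abelian.Ext

section
variable {C : Type*} [Category* C] [Abelian C] [HasExt.{u} C] {X Y : C}
  (P : ProjectiveResolution X)

lemma extMk_zero_eq_zero_iff (f : P.complex.X 0 ⟶ Y) (m : ℕ) (hm : 0 + 1 = m)
    (hf : P.complex.d m 0 ≫ f = 0) : P.extMk f m hm hf = 0 ↔ f = 0 := by
  refine ⟨fun h => ?_, by rintro rfl; simp⟩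
  have hz : Limits.IsZero (P.cochainComplex.X 1) :=
    CochainComplex.isZero_of_isStrictlyLE P.cochainComplex 0 1 (by lia)
  rw [← P.extEquivCohomologyClass.apply_eq_iff_eq, extEquivCohomologyClass_extMk,
    extEquivCohomologyClass_zero,
    CochainComplex.HomComplex.CohomologyClass.mk_eq_zero_iff,
    CochainComplex.HomComplex.Cocycle.toSingleMk_mem_coboundaries_iff _ _ _ _ _ 1 (by simp)] at h
  obtain ⟨g, hg⟩ := h
  rw [hz.eq_of_src g 0, Limits.comp_zero] at hg
  exact (cancel_epi (P.cochainComplexXIso (-(0 : ℕ)) 0 rfl).hom).1 (by rw [← hg, Limits.comp_zero])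

end

variable {R : Type u} [CommRing R] {X X' Y : ModuleCat.{u} R} (P : ProjectiveResolution X)
  (P' : ProjectiveResolution X') (n : ℕ)

variable (Y) in
/-- The morphism of cochain complexes of morphisms to `Y` induced by a morphism of
chain complexes. -/
noncomputable def linearYonedaMap {K L : ChainComplex (ModuleCat.{u} R) ℕ} (φ : K ⟶ L) :
    L.linearYonedaObj R Y ⟶ K.linearYonedaObj R Y :=
  (unopFunctor _ _).map ((((linearYoneda R _).obj Y).rightOp.mapHomologicalComplex _).map φ).op

variable (Y) in
/-- The underlying morphism of a cocycle in the complex of morphisms to `Y`. -/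
noncomputable def cocycleHom :
    (P.complex.linearYonedaObj R Y).cycles n →ₗ[R] (P.complex.X n ⟶ Y) :=
  ((P.complex.linearYonedaObj R Y).iCycles n).hom

lemma cocycleHom_injective : Function.Injective (P.cocycleHom Y n) :=
  (ModuleCat.mono_iff_injective ((P.complex.linearYonedaObj R Y).iCycles n)).1 inferInstance

lemma d_comp_cocycleHom (z : (P.complex.linearYonedaObj R Y).cycles n) :
    P.complex.d (n + 1) n ≫ P.cocycleHom Y n z = 0 :=
  congr($((P.complex.linearYonedaObj R Y).iCycles_d n (n + 1)).hom z)

lemma exists_cocycleHom_eq (f : P.complex.X n ⟶ Y) (hf : P.complex.d (n + 1) n ≫ f = 0) :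
    ∃ z, P.cocycleHom Y n z = f := by
  let S := (P.complex.linearYonedaObj R Y).sc n
  have hx : S.g.hom f = 0 := by
    change ((P.complex.linearYonedaObj R Y).d n ((ComplexShape.up ℕ).next n)).hom f = 0
    rw [CochainComplex.next]
    exact hf
  exact ⟨S.moduleCatCyclesIso.inv.hom ⟨f, hx⟩,
    congr($(S.moduleCatCyclesIso_inv_iCycles).hom ⟨f, hx⟩)⟩

variable (Y) in
/-- The class in `Ext X Y n` of a cocycle in the complex of morphisms from a
projective resolution of `X` to `Y`. -/
noncomputable def cyclesToExt :
    (P.complex.linearYonedaObj R Y).cycles n →ₗ[R] Abelian.Ext X Y n where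
  toFun z := P.extMk (P.cocycleHom Y n z) (n + 1) rfl (P.d_comp_cocycleHom n z)
  map_add' z w := by
    rw [P.add_extMk]
    simp only [map_add]
  map_smul' r z := by
    rw [RingHom.id_apply, smul_eq_comp_mk₀, P.extMk_comp_mk₀]
    congr 1
    rw [map_smul, Linear.comp_smul, Category.comp_id]

lemma cyclesToExt_apply (z : (P.complex.linearYonedaObj R Y).cycles n) :
    P.cyclesToExt Y n z =
      P.extMk (P.cocycleHom Y n z) (n + 1) rfl (P.d_comp_cocycleHom n z) := rfl

lemma cyclesToExt_surjective : Function.Surjective (P.cyclesToExt Y n) := by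
  intro x
  obtain ⟨f, hf, rfl⟩ := P.extMk_surjective x (n + 1) rfl
  obtain ⟨z, rfl⟩ := P.exists_cocycleHom_eq n f hf
  exact ⟨z, rfl⟩

lemma homologyπ_eq_zero_iff (K : CochainComplex (ModuleCat.{u} R) ℕ) (z : K.cycles n) :
    (K.homologyπ n).hom z = 0 ↔
      ∃ x, (K.toCycles ((ComplexShape.up ℕ).prev n) n).hom x = z := by
  have h := (ShortComplex.moduleCat_exact_iff _).1
    (ShortComplex.exact_of_g_is_cokernel (.mk (K.toCycles _ n) (K.homologyπ n) (by simp)) (K.homologyIsCokernel _ n rfl))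
  refine ⟨h z, ?_⟩
  rintro ⟨x, rfl⟩
  exact congr($(K.toCycles_comp_homologyπ _ n).hom x)

lemma cyclesToExt_eq_zero_iff (z : (P.complex.linearYonedaObj R Y).cycles n) :
    P.cyclesToExt Y n z = 0 ↔ ((P.complex.linearYonedaObj R Y).homologyπ n).hom z = 0 := by
  rw [homologyπ_eq_zero_iff, cyclesToExt_apply]
  have key (p : ℕ) (x : (P.complex.linearYonedaObj R Y).X p) :
      P.cocycleHom Y n (((P.complex.linearYonedaObj R Y).toCycles p n).hom x) =
        ((P.complex.linearYonedaObj R Y).d p n).hom x :=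
    congr($((P.complex.linearYonedaObj R Y).toCycles_i p n).hom x)
  simp only [← (P.cocycleHom_injective n).eq_iff, key]
  rcases n with _ | p
  · rw [extMk_zero_eq_zero_iff, CochainComplex.prev_nat_zero,
      (P.complex.linearYonedaObj R Y).shape 0 0 (by simp)]
    exact ⟨fun h => ⟨0, h.symm⟩, fun ⟨_, h⟩ => h.symm⟩
  · rw [P.extMk_eq_zero_iff _ _ _ _ p rfl, CochainComplex.prev_nat_succ]
    exact Iff.rfl

variable (Y) in
/-- The identification of `Ext X Y n` with the homology of the complex of morphisms from a
projective resolution of `X` to `Y`. -/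
noncomputable def homologyEquivExt :
    (P.complex.linearYonedaObj R Y).homology n ≃ₗ[R] Abelian.Ext X Y n :=
  have hπ : Function.Surjective ((P.complex.linearYonedaObj R Y).homologyπ n).hom :=
    (ModuleCat.epi_iff_surjective _).1 inferInstance
  (((P.complex.linearYonedaObj R Y).homologyπ n).hom.quotKerEquivOfSurjective hπ).symm.trans
  ((Submodule.quotEquivOfEq _ _ (by ext z; exact (P.cyclesToExt_eq_zero_iff n z).symm)).trans
    ((P.cyclesToExt Y n).quotKerEquivOfSurjective (P.cyclesToExt_surjective n)))

lemma homologyEquivExt_homologyπ (z : (P.complex.linearYonedaObj R Y).cycles n) :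
    P.homologyEquivExt Y n (((P.complex.linearYonedaObj R Y).homologyπ n).hom z) =
      P.cyclesToExt Y n z := by
  have hπ : Function.Surjective ((P.complex.linearYonedaObj R Y).homologyπ n).hom :=
    (ModuleCat.epi_iff_surjective _).1 inferInstance
  have : (((P.complex.linearYonedaObj R Y).homologyπ n).hom.quotKerEquivOfSurjective hπ).symm
      (((P.complex.linearYonedaObj R Y).homologyπ n).hom z) = Submodule.Quotient.mk z := by
    rw [LinearEquiv.symm_apply_eq]
    rfl
  simp only [homologyEquivExt, LinearEquiv.trans_apply, this]
  rfl

lemma homologyEquivExt_homologyMap {P P'} {g : X' ⟶ X} (φ : Hom P' P g)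
    (x : (P.complex.linearYonedaObj R Y).homology n) :
    P'.homologyEquivExt Y n ((homologyMap (linearYonedaMap Y φ.hom) n).hom x) =
      (mk₀ g).comp (P.homologyEquivExt Y n x) (zero_add n) := by
  obtain ⟨z, rfl⟩ : ∃ z, ((P.complex.linearYonedaObj R Y).homologyπ n).hom z = x :=
    (ModuleCat.epi_iff_surjective _).1 inferInstance x
  have h : (homologyMap (linearYonedaMap Y φ.hom) n).hom
      (((P.complex.linearYonedaObj R Y).homologyπ n).hom z) =
      ((P'.complex.linearYonedaObj R Y).homologyπ n).hom
        ((cyclesMap (linearYonedaMap Y φ.hom) n).hom z) :=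
    congr($(homologyπ_naturality (linearYonedaMap Y φ.hom) n).hom z)
  have h' : P'.cocycleHom Y n ((cyclesMap (linearYonedaMap Y φ.hom) n).hom z) =
      φ.hom.f n ≫ P.cocycleHom Y n z :=
    congr($(cyclesMap_i (linearYonedaMap Y φ.hom) n).hom z)
  rw [h, homologyEquivExt_homologyπ, homologyEquivExt_homologyπ, cyclesToExt_apply,
    cyclesToExt_apply, mk₀_comp_extMk _ _ _ _ φ]
  congr 1

lemma isoExt_hom_naturality {P P'} {g : X' ⟶ X} (φ : Hom P' P g) :
    ((_root_.Ext R (ModuleCat.{u} R) n).map g.op).app Y ≫ (P'.isoExt n Y).hom =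
      (P.isoExt n Y).hom ≫ homologyMap (linearYonedaMap Y φ.hom) n := by
  let F := ((linearYoneda R (ModuleCat.{u} R)).obj Y).rightOp
  have h1 : CommSq (P'.isoLeftDerivedObj F n).inv
      (homologyMap ((F.mapHomologicalComplex _).map φ.hom) n) ((F.leftDerived n).map g)
      (P.isoLeftDerivedObj F n).inv :=
    ⟨isoLeftDerivedObj_inv_naturality g P' P φ.hom (φ.hom_f_zero_comp_π_f_zero.trans
      congr(P'.π.f 0 ≫ $(ChainComplex.single₀_map_f_zero g))) F n⟩
  have h2 : CommSq (homologyMap (linearYonedaMap Y φ.hom) n).op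
      (homologyOp (P'.complex.linearYonedaObj R Y) n).inv
      (homologyOp (P.complex.linearYonedaObj R Y) n).inv
      (homologyMap ((F.mapHomologicalComplex _).map φ.hom) n) :=
    CommSq.vert_inv ⟨homologyOp_hom_naturality (linearYonedaMap Y φ.hom) n⟩
  exact (h2.flip.horiz_comp h1).unop.w.symm

end CategoryTheory.ProjectiveResolution

section

variable {R : Type u} [CommRing R]
open Abelian.Ext

/-- The comparison between the two definitions of Ext-modules: by deriving the functor of
morphisms in the first variable, and as morphisms in the derived category. -/
noncomputable def derivedExtEquiv (X Y : ModuleCat.{u} R) (n : ℕ) :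
    ((_root_.Ext R (ModuleCat.{u} R) n).obj (.op X)).obj Y ≃ₗ[R] Abelian.Ext X Y n :=
  ((projectiveResolution X).isoExt n Y).toLinearEquiv.trans
    ((projectiveResolution X).homologyEquivExt Y n)

lemma derivedExtEquiv_map {X' X : ModuleCat.{u} R} (g : X' ⟶ X) (Y : ModuleCat.{u} R) (n : ℕ)
    (x : ((_root_.Ext R (ModuleCat.{u} R) n).obj (.op X)).obj Y) :
    derivedExtEquiv X' Y n ((((_root_.Ext R (ModuleCat.{u} R) n).map g.op).app Y).hom x) =
      (mk₀ g).comp (derivedExtEquiv X Y n x) (zero_add n) := by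
  let φ : ProjectiveResolution.Hom (projectiveResolution X') (projectiveResolution X) g :=
    ⟨ProjectiveResolution.lift g _ _, by
      simpa using ProjectiveResolution.lift_commutes_zero g (projectiveResolution X')
        (projectiveResolution X)⟩
  have h : ((projectiveResolution X').isoExt n Y).hom.hom
      ((((_root_.Ext R (ModuleCat.{u} R) n).map g.op).app Y).hom x) =
      (HomologicalComplex.homologyMap (ProjectiveResolution.linearYonedaMap Y φ.hom) n).hom
        (((projectiveResolution X).isoExt n Y).hom.hom x) :=
    congr($(ProjectiveResolution.isoExt_hom_naturality n φ).hom x)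
  exact .trans congr((projectiveResolution X').homologyEquivExt Y n $h)
    (ProjectiveResolution.homologyEquivExt_homologyMap n φ _)

/-- The projection `R ⧸ I ⟶ R ⧸ J` for ideals `I ≤ J`. -/
noncomputable abbrev quotientProj {I J : Ideal R} (h : I ≤ J) :
    ModuleCat.of R (R ⧸ I) ⟶ ModuleCat.of R (R ⧸ J) :=
  ModuleCat.ofHom (Submodule.mapQ I J LinearMap.id h)

/-- A linear map from `Hⁱ_J(M)` which is an isomorphism can be constructed from a compatible
family of linear maps on the modules `Extⁱ(R ⧸ J ^ t, M)` which is jointly surjective and whose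
kernels vanish in the colimit. -/
theorem nonempty_localCohomology_linearEquiv (J : Ideal R) (i : ℕ) (M : ModuleCat.{u} R)
    {N : Type u} [AddCommGroup N] [Module R N]
    (φ : ∀ t : ℕ, Abelian.Ext (ModuleCat.of R (R ⧸ J ^ t)) M i →ₗ[R] N)
    (hφ : ∀ (t s : ℕ) (h : t ≤ s) (x : Abelian.Ext (ModuleCat.of R (R ⧸ J ^ t)) M i),
      φ s ((mk₀ (quotientProj (Ideal.pow_le_pow_right h))).comp x (zero_add i)) = φ t x)
    (hsurj : ∀ y, ∃ t x, φ t x = y)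
    (hker : ∀ t x, φ t x = 0 → ∃ (s : ℕ) (h : t ≤ s),
      (mk₀ (quotientProj (Ideal.pow_le_pow_right (I := J) h))).comp x (zero_add i) = 0) :
    Nonempty (((localCohomology J i).obj M) ≃ₗ[R] N) := by
  let D := localCohomology.diagram (localCohomology.idealPowersDiagram J) i
  let G : (ℕᵒᵖ)ᵒᵖ ⥤ ModuleCat.{u} R := D ⋙ (evaluation _ _).obj M
  let c : Limits.Cocone G := ((evaluation _ _).obj M).mapCocone (Limits.colimit.cocone D)
  have hc : Limits.IsColimit c :=
    Limits.isColimitOfPreserves ((evaluation _ _).obj M) (Limits.colimit.isColimit D)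
  let e (t : (ℕᵒᵖ)ᵒᵖ) : G.obj t ≃ₗ[R] Abelian.Ext (ModuleCat.of R (R ⧸ J ^ t.unop.unop)) M i :=
    derivedExtEquiv _ _ i
  have he {t s : (ℕᵒᵖ)ᵒᵖ} (f : t ⟶ s) (x : G.obj t) : e s ((G.map f).hom x) =
      (mk₀ (quotientProj (Ideal.pow_le_pow_right f.unop.unop.down.down))).comp
        (e t x) (zero_add i) := derivedExtEquiv_map _ _ _ x
  let d : Limits.Cocone G :=
    { pt := ModuleCat.of R N
      ι :=
        { app t := ModuleCat.ofHom (φ t.unop.unop ∘ₗ (e t).toLinearMap)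
          naturality t s f := by
            ext x
            change φ _ (e s ((G.map f).hom x)) = φ _ (e t x)
            rw [he, hφ _ _ f.unop.unop.down.down] } }
  have hd (t) (x : G.obj t) : (hc.desc d).hom ((c.ι.app t).hom x) = φ t.unop.unop (e t x) :=
    congr($(hc.fac d t).hom x)
  have : Limits.PreservesFilteredColimitsOfSize.{0, 0} (forget (ModuleCat.{u} R)) :=
    Limits.preservesFilteredColimitsOfSize_shrink _
  refine ⟨LinearEquiv.ofBijective (hc.desc d).hom ⟨?_, ?_⟩⟩
  · rw [injective_iff_map_eq_zero]
    intro x hx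
    obtain ⟨t, x, rfl⟩ := Limits.Concrete.isColimit_exists_rep G hc x
    obtain ⟨s, h, hs⟩ := hker _ _ ((hd t x).symm.trans hx)
    let f : t ⟶ .op (.op s) := (homOfLE h).op.op
    have hf : (G.map f).hom x = 0 := (e _).injective (by
      rw [he, map_zero]; exact hs)
    have := congr($(c.w f).hom x)
    rw [ModuleCat.comp_apply, hf, map_zero] at this
    exact this.symm
  · intro y
    obtain ⟨t, x, rfl⟩ := hsurj y
    exact ⟨(c.ι.app (.op (.op t))).hom ((e (.op (.op t))).symm x), by
      rw [hd, LinearEquiv.apply_symm_apply]⟩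

theorem subsingleton_localCohomology (J : Ideal R) (i : ℕ) (M : ModuleCat.{u} R)
    (h : ∀ (t : ℕ) (x : Abelian.Ext (ModuleCat.of R (R ⧸ J ^ t)) M i), ∃ (s : ℕ) (h : t ≤ s),
      (mk₀ (quotientProj (Ideal.pow_le_pow_right (I := J) h))).comp x (zero_add i) = 0) :
    Subsingleton ((localCohomology J i).obj M) := by
  obtain ⟨e⟩ := nonempty_localCohomology_linearEquiv J i M (N := PUnit) 0
    (fun _ _ _ _ => rfl) (fun _ => ⟨0, 0, rfl⟩) (fun t x _ => h t x)
  exact e.toEquiv.subsingleton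

end

namespace RingTheory.Sequence.IsWeaklyRegular
open Function Pointwise

variable {R : Type*} [CommRing R]

lemma of_exact_s16 {A B C : Type*} [AddCommGroup A] [AddCommGroup B] [AddCommGroup C]
    [Module R A] [Module R B] [Module R C] {f : A →ₗ[R] B} {g : B →ₗ[R] C}
    (hf : Injective f) (hfg : Exact f g) (hg : Surjective g) {rs : List R}
    (hA : IsWeaklyRegular A rs) (hC : IsWeaklyRegular C rs) : IsWeaklyRegular B rs := by
  induction rs generalizing A B C with
  | nil => exact .nil R B
  | cons r rs ih =>
    rw [isWeaklyRegular_cons_iff] at hA hC ⊢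
    have hker : Exact (QuotSMulTop.map r (0 : A →ₗ[R] A)) (QuotSMulTop.map r f) :=
      QuotSMulTop.map_first_exact_on_four_term_exact_of_isSMulRegular_last
        ((LinearMap.exact_zero_iff_injective A f).2 hf) hfg hC.1
    rw [map_zero] at hker
    exact ⟨isSMulRegular_of_range_eq_ker hf (LinearMap.exact_iff.1 hfg).symm hA.1 hC.1,
      ih ((LinearMap.exact_zero_iff_injective _ _).1 hker) (QuotSMulTop.map_exact r hfg hg)
        (QuotSMulTop.map_surjective r hg) hA.2 hC.2⟩

lemma of_subsingleton_s16 {M : Type*} [AddCommGroup M] [Module R M] [Subsingleton M]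
    (rs : List R) : IsWeaklyRegular M rs :=
  ⟨fun _ _ _ _ _ => Subsingleton.elim _ _⟩

lemma quotSMulTop_pow {M : Type*} [AddCommGroup M] [Module R M] {r : R}
    (hr : IsSMulRegular M r) {rs : List R} (h : IsWeaklyRegular (QuotSMulTop r M) rs) (e : ℕ) :
    IsWeaklyRegular (QuotSMulTop (r ^ e) M) rs := by
  induction e with
  | zero =>
    have : Subsingleton (QuotSMulTop (r ^ 0) M) := by
      rw [Submodule.Quotient.subsingleton_iff, pow_zero, one_smul]
    exact of_subsingleton_s16 rs
  | succ e ih =>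
    have h₁ : (r ^ e • ⊤ : Submodule R M) ≤
        (r ^ (e + 1) • ⊤ : Submodule R M).comap (LinearMap.lsmul R M r) := by
      rintro _ ⟨m, -, rfl⟩
      exact ⟨m, trivial, by simp [pow_succ', mul_smul, smul_comm r]⟩
    have h₂ : (r ^ (e + 1) • ⊤ : Submodule R M) ≤ r • ⊤ := by
      rintro _ ⟨m, -, rfl⟩
      exact ⟨r ^ e • m, trivial, by simp [pow_succ', mul_smul, smul_comm r]⟩
    refine of_exact_s16 (f := Submodule.mapQ _ _ (LinearMap.lsmul R M r) h₁)
      (g := Submodule.factor h₂) ?_ ?_ (Submodule.factor_surjective h₂) ih h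
    · rw [← LinearMap.ker_eq_bot, Submodule.ker_mapQ, ← le_bot_iff, Submodule.map_le_iff_le_comap]
      rintro m ⟨m', -, hm⟩
      rw [Submodule.comap_bot, Submodule.ker_mkQ]
      refine ⟨m', trivial, hr ?_⟩
      simpa [pow_succ', mul_smul] using hm
    · intro x
      obtain ⟨m, rfl⟩ := Submodule.Quotient.mk_surjective _ x
      constructor
      · intro hm
        obtain ⟨m', -, rfl⟩ := (Submodule.Quotient.mk_eq_zero _).1 hm
        exact ⟨Submodule.Quotient.mk m', rfl⟩
      · rintro ⟨y, hy⟩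
        obtain ⟨m', rfl⟩ := Submodule.Quotient.mk_surjective _ y
        rw [← hy]
        exact (Submodule.Quotient.mk_eq_zero _).2 ⟨m', trivial, rfl⟩

lemma map_pow_s16 {M : Type*} [AddCommGroup M] [Module R M] {rs : List R}
    (h : IsWeaklyRegular M rs) (e : ℕ) : IsWeaklyRegular M (rs.map (· ^ e)) := by
  induction h with
  | nil => exact .nil R _
  | cons r rs h₁ _ ih =>
    exact .cons (h₁.pow e) (quotSMulTop_pow h₁ ih e)

end RingTheory.Sequence.IsWeaklyRegular

section

variable {R : Type u} [CommRing R]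

/-- The ideal generated by the `t`-th powers of the first `k` terms of a sequence. -/
def powersIdeal (a : ℕ → R) (k t : ℕ) : Ideal R := Ideal.ofList ((List.range k).map (a · ^ t))

lemma powersIdeal_zero (a : ℕ → R) (t : ℕ) : powersIdeal a 0 t = ⊥ := by
  simp [powersIdeal, Ideal.ofList_nil]

lemma powersIdeal_succ (a : ℕ → R) (k t : ℕ) :
    powersIdeal a (k + 1) t = powersIdeal a k t ⊔ Ideal.span {a k ^ t} := by
  simp [powersIdeal, List.range_succ, Ideal.ofList_append]

lemma pow_mem_powersIdeal (a : ℕ → R) {k j : ℕ} (hj : j < k) (t : ℕ) :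
    a j ^ t ∈ powersIdeal a k t :=
  Ideal.subset_span (List.mem_map.2 ⟨j, List.mem_range.2 hj, rfl⟩)

lemma powersIdeal_le_iff {a : ℕ → R} {k t : ℕ} {I : Ideal R} :
    powersIdeal a k t ≤ I ↔ ∀ j < k, a j ^ t ∈ I := by
  simp [powersIdeal, Ideal.ofList, Ideal.span_le, Set.subset_def]

lemma powersIdeal_anti (a : ℕ → R) (k : ℕ) : Antitone (powersIdeal a k) := fun _ _ h =>
  powersIdeal_le_iff.2 fun _ hj => Ideal.mem_of_dvd _ (pow_dvd_pow _ h) (pow_mem_powersIdeal a hj _)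

lemma isSMulRegular_powersIdeal {a : ℕ → R} {n : ℕ}
    (h : RingTheory.Sequence.IsWeaklyRegular R ((List.range n).map a)) {k : ℕ} (hk : k < n)
    (t : ℕ) : IsSMulRegular (R ⧸ powersIdeal a k t) (a k ^ t) := by
  have h' := h.map_pow_s16 t
  rw [List.map_map] at h'
  have h'' := h'.regular_mod_prev k (by simpa using hk)
  rw [← List.map_take, List.take_range, min_eq_left hk.le] at h''
  rw [smul_eq_mul, Ideal.mul_top, List.getElem_map, List.getElem_range] at h''
  exact h''

end
section

variable {R : Type u} [CommRing R]
open Abelian.Ext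

@[simp]
lemma quotientProj_comp {I J K : Ideal R} (h : I ≤ J) (h' : J ≤ K) :
    quotientProj h ≫ quotientProj h' = quotientProj (h.trans h') := by
  ext
  rfl

lemma powersIdeal_le_succ (a : ℕ → R) (k t : ℕ) : powersIdeal a k t ≤ powersIdeal a (k + 1) t :=
  le_sup_left.trans_eq (powersIdeal_succ a k t).symm

/-- The sequence `R ⧸ J ⟶ R ⧸ J ⟶ R ⧸ J'` where `J` and `J'` are generated by the `t`-th powers of
the first `k` and `k + 1` terms of the sequence `a`, and the first map is the
multiplication by `a k ^ t`. -/
noncomputable def powersShortComplex (a : ℕ → R) (k t : ℕ) : ShortComplex (ModuleCat.{u} R) where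
  X₁ := ModuleCat.of R (R ⧸ powersIdeal a k t)
  X₂ := ModuleCat.of R (R ⧸ powersIdeal a k t)
  X₃ := ModuleCat.of R (R ⧸ powersIdeal a (k + 1) t)
  f := a k ^ t • 𝟙 _
  g := quotientProj (powersIdeal_le_succ a k t)
  zero := by
    ext
    exact (Submodule.Quotient.mk_eq_zero _).2
      (Ideal.mul_mem_right _ _ (pow_mem_powersIdeal a k.lt_succ_self t))

lemma powersShortComplex_shortExact {a : ℕ → R} {k t : ℕ}
    (h : IsSMulRegular (R ⧸ powersIdeal a k t) (a k ^ t)) :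
    (powersShortComplex a k t).ShortExact where
  exact := by
    rw [ShortComplex.moduleCat_exact_iff]
    intro x hx
    obtain ⟨x, rfl⟩ := Submodule.Quotient.mk_surjective _ x
    have hx' : x ∈ powersIdeal a (k + 1) t := (Submodule.Quotient.mk_eq_zero _).1 hx
    rw [powersIdeal_succ] at hx'
    obtain ⟨y, hy, z, hz, rfl⟩ := Submodule.mem_sup.1 hx'
    obtain ⟨c, rfl⟩ := Ideal.mem_span_singleton'.1 hz
    refine ⟨Submodule.Quotient.mk c, ?_⟩
    refine (Submodule.Quotient.eq _).2 ?_
    have : a k ^ t • c - (y + c * a k ^ t) = - y := by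
      rw [smul_eq_mul]
      ring
    rw [this]
    exact neg_mem hy
  mono_f := (ModuleCat.mono_iff_injective _).2 h
  epi_g := (ModuleCat.epi_iff_surjective _).2 (Submodule.factor_surjective (powersIdeal_le_succ a k t))

/-- The morphism of short complexes induced by the projections. -/
noncomputable def powersShortComplexMap (a : ℕ → R) (k t m : ℕ) :
    powersShortComplex a k (t + m) ⟶ powersShortComplex a k t where
  τ₁ := a k ^ m • quotientProj (powersIdeal_anti a k (Nat.le_add_right t m))
  τ₂ := quotientProj (powersIdeal_anti a k (Nat.le_add_right t m))
  τ₃ := quotientProj (powersIdeal_anti a (k + 1) (Nat.le_add_right t m))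
  comm₁₂ := by
    simp [powersShortComplex, smul_smul, pow_add]
  comm₂₃ := by
    simp [powersShortComplex]

lemma quotientProj_comp_ext {I J K : Ideal R} (h : I ≤ J) (h' : J ≤ K) {M : ModuleCat.{u} R}
    {i : ℕ} (x : Abelian.Ext (ModuleCat.of R (R ⧸ K)) M i) :
    (mk₀ (quotientProj h)).comp ((mk₀ (quotientProj h')).comp x (zero_add i)) (zero_add i) =
      (mk₀ (quotientProj (h.trans h'))).comp x (zero_add i) := by
  rw [mk₀_comp_mk₀_assoc, quotientProj_comp]

lemma exists_pow_smul_eq_zero_of_shortExact {S : ShortComplex (ModuleCat.{u} R)}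
    (hS : S.ShortExact) {M : ModuleCat.{u} R} {b : R} {i : ℕ} (x : Abelian.Ext S.X₃ M (i + 1))
    (h₂ : ∃ e : ℕ, b ^ e • (mk₀ S.g).comp x (zero_add _) = 0)
    (h₁ : ∀ z : Abelian.Ext S.X₁ M i, ∃ e : ℕ, b ^ e • z = 0) : ∃ e : ℕ, b ^ e • x = 0 := by
  obtain ⟨e, he⟩ := h₂
  rw [← comp_smul] at he
  obtain ⟨z, hz⟩ := contravariant_sequence_exact₃ hS M (b ^ e • x) he (add_comm 1 i)
  obtain ⟨e', he'⟩ := h₁ z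
  exact ⟨e' + e, by rw [pow_add, mul_smul, ← hz, ← comp_smul, he', comp_zero]⟩

lemma mk₀_comp_extClass_comp_eq_zero {S S' : ShortComplex (ModuleCat.{u} R)}
    (hS : S.ShortExact) (hS' : S'.ShortExact) (f : S ⟶ S') {r : R} {g : S.X₁ ⟶ S'.X₁}
    (hf : f.τ₁ = r • g) {M : ModuleCat.{u} R} {i : ℕ} {z : Abelian.Ext S'.X₁ M i}
    (hz : r • z = 0) :
    (mk₀ f.τ₃).comp (hS'.extClass.comp z (add_comm 1 i)) (zero_add (i + 1)) = 0 := by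
  rw [← comp_assoc (a₁₂ := 1) _ _ _ (by lia) (by lia) (by lia),
    ← ShortComplex.ShortExact.extClass_naturality hS hS' f,
    comp_assoc_of_second_deg_zero, hf, mk₀_smul, smul_comp, ← comp_smul, hz, comp_zero, comp_zero]

instance projective_quotient_powersIdeal_zero (a : ℕ → R) (t : ℕ) :
    Projective (ModuleCat.of R (R ⧸ powersIdeal a 0 t)) := by
  have : Module.Projective R (R ⧸ powersIdeal a 0 t) := .of_equiv
    (Submodule.quotEquivOfEqBot _ (powersIdeal_zero a t)).symm
  infer_instance

lemma exists_pow_smul_ext_eq_zero {M : ModuleCat.{u} R} {b : R}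
    (hb : ∀ m : M, ∃ e : ℕ, b ^ e • m = 0) {a : ℕ → R} {k t : ℕ}
    (h : ∀ j < k, IsSMulRegular (R ⧸ powersIdeal a j t) (a j ^ t)) {i : ℕ}
    (x : Abelian.Ext (ModuleCat.of R (R ⧸ powersIdeal a k t)) M i) :
    ∃ e : ℕ, b ^ e • x = 0 := by
  induction i generalizing k with
  | zero =>
    obtain ⟨f, rfl⟩ := (mk₀_bijective _ _).2 x
    obtain ⟨e, he⟩ := hb (f.hom (Submodule.Quotient.mk 1))
    refine ⟨e, ?_⟩
    rw [← mk₀_smul, mk₀_eq_zero_iff]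
    ext
    exact he
  | succ i ih =>
    induction k with
    | zero => exact ⟨0, by rw [eq_zero_of_projective x, smul_zero]⟩
    | succ k ihk =>
      exact exists_pow_smul_eq_zero_of_shortExact
        (powersShortComplex_shortExact (h k k.lt_succ_self)) x
        (ihk (fun j hj => h j (hj.trans k.lt_succ_self)) _)
        (ih (fun j hj => h j (hj.trans k.lt_succ_self)))

lemma exists_quotientProj_powersIdeal_comp_eq_zero {M : ModuleCat.{u} R} {a : ℕ → R} {k : ℕ}
    (h : ∀ j < k, ∀ t : ℕ, IsSMulRegular (R ⧸ powersIdeal a j t) (a j ^ t))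
    (hM : ∀ j < k, ∀ m : M, ∃ e : ℕ, a j ^ e • m = 0) {i t : ℕ}
    (x : Abelian.Ext (ModuleCat.of R (R ⧸ powersIdeal a k t)) M (i + 1)) :
    ∃ (s : ℕ) (hs : t ≤ s), (mk₀ (quotientProj (powersIdeal_anti a k hs))).comp x
      (zero_add _) = 0 := by
  induction k with
  | zero => exact ⟨t, le_rfl, by rw [eq_zero_of_projective x, comp_zero]⟩
  | succ k ih =>
    have hS (t) := powersShortComplex_shortExact (h k k.lt_succ_self t)
    obtain ⟨s, hs, hs'⟩ := ih (fun j hj => h j (hj.trans k.lt_succ_self))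
      (fun j hj => hM j (hj.trans k.lt_succ_self))
      ((mk₀ (quotientProj (powersIdeal_le_succ a k t))).comp x (zero_add _))
    let y := (mk₀ (quotientProj (powersIdeal_anti a (k + 1) hs))).comp x (zero_add _)
    have hy : (mk₀ (quotientProj (powersIdeal_le_succ a k s))).comp y (zero_add _) = 0 := by
      rw [quotientProj_comp_ext] at hs' ⊢
      exact hs'
    obtain ⟨z, hz⟩ := contravariant_sequence_exact₃ (hS s) M y hy (add_comm 1 i)
    obtain ⟨m, hm⟩ := exists_pow_smul_ext_eq_zero (hM k k.lt_succ_self)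
      (fun j hj => h j (hj.trans k.lt_succ_self) s) z
    have hmy := mk₀_comp_extClass_comp_eq_zero (hS (s + m)) (hS s) (powersShortComplexMap a k s m)
      rfl hm
    rw [hz] at hmy
    refine ⟨s + m, hs.trans (Nat.le_add_right s m), ?_⟩
    rw [← quotientProj_comp_ext (powersIdeal_anti a (k + 1) (Nat.le_add_right s m))]
    exact hmy

end

section

variable {R : Type u} [CommRing R]
open Abelian.Ext

/-- Every element of `Extⁱ(R ⧸ J ^ t, M)` maps to zero in `Extⁱ(R ⧸ J ^ s, M)` for some `s ≥ t`. -/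
def ExtLocallyZero (J : Ideal R) (M : ModuleCat.{u} R) (i : ℕ) : Prop :=
  ∀ (t : ℕ) (x : Abelian.Ext (ModuleCat.of R (R ⧸ J ^ t)) M i), ∃ (s : ℕ) (h : t ≤ s),
    (mk₀ (quotientProj (Ideal.pow_le_pow_right (I := J) h))).comp x (zero_add i) = 0

lemma ExtLocallyZero.exists_comp_eq_zero {J : Ideal R} {S : ShortComplex (ModuleCat.{u} R)}
    (hS : S.ShortExact) {i : ℕ} (h₁ : ExtLocallyZero J S.X₁ i) {t : ℕ}
    (x : Abelian.Ext (ModuleCat.of R (R ⧸ J ^ t)) S.X₂ i)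
    (hx : x.comp (mk₀ S.g) (add_zero i) = 0) : ∃ (s : ℕ) (h : t ≤ s),
    (mk₀ (quotientProj (Ideal.pow_le_pow_right (I := J) h))).comp x (zero_add i) = 0 := by
  obtain ⟨y, rfl⟩ := covariant_sequence_exact₂ _ hS x hx
  obtain ⟨s, h, hs⟩ := h₁ t y
  exact ⟨s, h, by rw [← comp_assoc_of_third_deg_zero, hs, zero_comp]⟩

lemma ExtLocallyZero.of_shortExact {J : Ideal R} {S : ShortComplex (ModuleCat.{u} R)}
    (hS : S.ShortExact) {i : ℕ} (h₁ : ExtLocallyZero J S.X₁ i) (h₃ : ExtLocallyZero J S.X₃ i) :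
    ExtLocallyZero J S.X₂ i := by
  intro t x
  obtain ⟨s, h, hs⟩ := h₃ t (x.comp (mk₀ S.g) (add_zero i))
  rw [← comp_assoc_of_third_deg_zero] at hs
  obtain ⟨r, h', hr⟩ := h₁.exists_comp_eq_zero hS _ hs
  exact ⟨r, h.trans h', by rwa [quotientProj_comp_ext] at hr⟩

lemma ExtLocallyZero.exists_comp_eq {J : Ideal R} {S : ShortComplex (ModuleCat.{u} R)}
    (hS : S.ShortExact) {i : ℕ} (h₁ : ExtLocallyZero J S.X₁ (i + 1)) {t : ℕ}
    (y : Abelian.Ext (ModuleCat.of R (R ⧸ J ^ t)) S.X₃ i) : ∃ (s : ℕ) (h : t ≤ s)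
    (x : Abelian.Ext (ModuleCat.of R (R ⧸ J ^ s)) S.X₂ i), x.comp (mk₀ S.g) (add_zero i) =
      (mk₀ (quotientProj (Ideal.pow_le_pow_right (I := J) h))).comp y (zero_add i) := by
  obtain ⟨s, h, hs⟩ := h₁ t (y.comp hS.extClass rfl)
  rw [← comp_assoc _ _ _ (zero_add i) rfl (by lia)] at hs
  obtain ⟨x, hx⟩ := covariant_sequence_exact₃ _ hS _ rfl hs
  exact ⟨s, h, x, hx⟩

lemma ExtLocallyZero.of_subsingleton_s16 {J : Ideal R} {S : ShortComplex (ModuleCat.{u} R)}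
    (hS : S.ShortExact) {i : ℕ} (h₃ : ExtLocallyZero J S.X₃ i)
    (h₂ : ∀ t, Subsingleton (Abelian.Ext (ModuleCat.of R (R ⧸ J ^ t)) S.X₂ (i + 1))) :
    ExtLocallyZero J S.X₁ (i + 1) := by
  intro t x
  obtain ⟨y, rfl⟩ := covariant_sequence_exact₁ _ hS x (Subsingleton.elim _ _) rfl
  obtain ⟨s, h, hs⟩ := h₃ t y
  exact ⟨s, h, by rw [← comp_assoc _ _ _ (zero_add i) rfl (by lia), hs, zero_comp]⟩

/-- The isomorphism `Extⁱ(X, S.X₃) ≃ Extⁱ⁺¹(X, S.X₁)` given by a short exact sequence `S` such that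
the modules `Ext(X, S.X₂)` vanish. -/
noncomputable def extClassEquiv {S : ShortComplex (ModuleCat.{u} R)} (hS : S.ShortExact)
    {X : ModuleCat.{u} R} (h₂ : ∀ i, Subsingleton (Abelian.Ext X S.X₂ i)) (i : ℕ) :
    Abelian.Ext X S.X₃ i ≃ₗ[R] Abelian.Ext X S.X₁ (i + 1) :=
  .ofBijective (hS.extClass.postcompOfLinear R X rfl) ⟨by
    rw [injective_iff_map_eq_zero]
    intro x hx
    obtain ⟨y, rfl⟩ := covariant_sequence_exact₃ _ hS x rfl hx
    rw [(h₂ i).elim y 0, zero_comp],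
    fun x => covariant_sequence_exact₁ _ hS x ((h₂ (i + 1)).elim _ _) rfl⟩

/-- The evaluation at `1` of the homomorphisms from `R ⧸ I`. -/
noncomputable def extEvalOne (I : Ideal R) (M : ModuleCat.{u} R) :
    Abelian.Ext (ModuleCat.of R (R ⧸ I)) M 0 →ₗ[R] M where
  toFun x := (linearEquiv₀ (R := R) x).hom (Submodule.Quotient.mk 1)
  map_add' x y := by simp
  map_smul' r x := by simp

lemma extEvalOne_mk₀ {I : Ideal R} {M : ModuleCat.{u} R} (f : ModuleCat.of R (R ⧸ I) ⟶ M) :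
    extEvalOne I M (mk₀ f) = f.hom (Submodule.Quotient.mk 1) :=
  congr($(linearEquiv₀.apply_symm_apply (R := R) f).hom _)

lemma extEvalOne_injective (I : Ideal R) (M : ModuleCat.{u} R) :
    Function.Injective (extEvalOne I M) := by
  rw [injective_iff_map_eq_zero]
  intro x hx
  obtain ⟨f, rfl⟩ := (mk₀_bijective _ _).2 x
  rw [extEvalOne_mk₀] at hx
  rw [mk₀_eq_zero_iff]
  ext
  exact hx

lemma extEvalOne_quotientProj_comp {I J : Ideal R} (h : I ≤ J) {M : ModuleCat.{u} R}
    (x : Abelian.Ext (ModuleCat.of R (R ⧸ J)) M 0) :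
    extEvalOne I M ((mk₀ (quotientProj h)).comp x (zero_add 0)) = extEvalOne J M x := by
  obtain ⟨f, rfl⟩ := (mk₀_bijective _ _).2 x
  rw [mk₀_comp_mk₀, extEvalOne_mk₀, extEvalOne_mk₀]
  rfl

lemma smul_extEvalOne {I : Ideal R} {M : ModuleCat.{u} R}
    (x : Abelian.Ext (ModuleCat.of R (R ⧸ I)) M 0) {r : R} (hr : r ∈ I) :
    r • extEvalOne I M x = 0 := by
  obtain ⟨f, rfl⟩ := (mk₀_bijective _ _).2 x
  rw [extEvalOne_mk₀, ← map_smul, ← map_zero f.hom]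
  congr 1
  exact (Submodule.Quotient.mk_eq_zero _).2 (Ideal.mul_mem_right _ _ hr)

lemma exists_extEvalOne_eq {I : Ideal R} {M : ModuleCat.{u} R} {m : M}
    (hm : ∀ r ∈ I, r • m = 0) : ∃ x, extEvalOne I M x = m :=
  ⟨mk₀ (ModuleCat.ofHom (Submodule.liftQ I (LinearMap.toSpanSingleton R M m) hm)), by
    rw [extEvalOne_mk₀]
    exact one_smul R m⟩

lemma nonempty_localCohomology_zero_linearEquiv {J : Ideal R} {M : ModuleCat.{u} R}
    {N : Submodule R M} (hN : ∀ m : M, m ∈ N ↔ ∃ t : ℕ, ∀ r ∈ J ^ t, r • m = 0) :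
    Nonempty ((localCohomology J 0).obj M ≃ₗ[R] N) := by
  refine nonempty_localCohomology_linearEquiv J 0 M
    (fun t => (extEvalOne (J ^ t) M).codRestrict N fun x =>
      (hN _).2 ⟨t, fun r hr => smul_extEvalOne x hr⟩) ?_ ?_ ?_
  · intro t s h x
    exact Subtype.ext (extEvalOne_quotientProj_comp _ x)
  · rintro ⟨m, hm⟩
    obtain ⟨t, ht⟩ := (hN m).1 hm
    obtain ⟨x, hx⟩ := exists_extEvalOne_eq ht
    exact ⟨t, x, Subtype.ext hx⟩
  · intro t x hx
    have : x = 0 := extEvalOne_injective _ _ ((congr_arg Subtype.val hx).trans (map_zero _).symm)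
    exact ⟨t, le_rfl, by rw [this, comp_zero]⟩

lemma nonempty_localCohomology_one_linearEquiv {J : Ideal R} {T M N L C : ModuleCat.{u} R}
    {f : T ⟶ M} {g : M ⟶ N} {w : f ≫ g = 0} (hS : (ShortComplex.mk f g w).ShortExact)
    {f' : N ⟶ L} {g' : L ⟶ C} {w' : f' ≫ g' = 0} (hS' : (ShortComplex.mk f' g' w').ShortExact)
    (h₁ : ExtLocallyZero J T 1) (h₂ : ExtLocallyZero J T 2)
    (hL : ∀ t i, Subsingleton (Abelian.Ext (ModuleCat.of R (R ⧸ J ^ t)) L i))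
    (hC : ∀ m : C, ∃ t : ℕ, ∀ r ∈ J ^ t, r • m = 0) :
    Nonempty ((localCohomology J 1).obj M ≃ₗ[R] C) := by
  let δ (t : ℕ) := extClassEquiv hS' (hL t) 0
  let φ (t : ℕ) : Abelian.Ext (ModuleCat.of R (R ⧸ J ^ t)) M 1 →ₗ[R] C :=
    extEvalOne (J ^ t) C ∘ₗ (δ t).symm.toLinearMap ∘ₗ
      (mk₀ g).postcompOfLinear R _ (add_zero 1)
  have hφ {t : ℕ} {x : Abelian.Ext (ModuleCat.of R (R ⧸ J ^ t)) M 1}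
      {c : Abelian.Ext (ModuleCat.of R (R ⧸ J ^ t)) C 0}
      (h : c.comp hS'.extClass (zero_add 1) = x.comp (mk₀ g) (add_zero 1)) :
      φ t x = extEvalOne _ _ c := by
    have : (δ t).symm (x.comp (mk₀ g) (add_zero 1)) = c := by
      rw [LinearEquiv.symm_apply_eq, ← h]
      rfl
    exact congr_arg (extEvalOne _ C) this
  have hδ {t : ℕ} (x : Abelian.Ext (ModuleCat.of R (R ⧸ J ^ t)) M 1) :
      ∃ c : Abelian.Ext (ModuleCat.of R (R ⧸ J ^ t)) C 0,
        c.comp hS'.extClass (zero_add 1) = x.comp (mk₀ g) (add_zero 1) :=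
    (δ t).surjective _
  refine nonempty_localCohomology_linearEquiv J 1 M φ ?_ ?_ ?_
  · intro t s h x
    obtain ⟨c, hc⟩ := hδ x
    rw [hφ hc, ← extEvalOne_quotientProj_comp (Ideal.pow_le_pow_right h)]
    apply hφ
    rw [comp_assoc _ _ _ (zero_add 0) (zero_add 1) (by lia), hc, comp_assoc_of_third_deg_zero]
  · intro m
    obtain ⟨t, ht⟩ := hC m
    obtain ⟨c, rfl⟩ := exists_extEvalOne_eq ht
    obtain ⟨s, h, x, hx⟩ := ExtLocallyZero.exists_comp_eq hS h₂ (c.comp hS'.extClass (zero_add 1))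
    refine ⟨s, x, ?_⟩
    rw [← extEvalOne_quotientProj_comp (Ideal.pow_le_pow_right h)]
    apply hφ
    rw [comp_assoc _ _ _ (zero_add 0) (zero_add 1) (by lia)]
    exact hx.symm
  · intro t x hx
    obtain ⟨c, hc⟩ := hδ x
    rw [hφ hc] at hx
    have : c = 0 := extEvalOne_injective _ _ (hx.trans (map_zero _).symm)
    rw [this, zero_comp] at hc
    exact ExtLocallyZero.exists_comp_eq_zero hS h₁ x hc.symm

lemma subsingleton_ext_of_smul {X Y : ModuleCat.{u} R} {r : R} (hX : ∀ x : X, r • x = 0)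
    (hY : Function.Bijective fun y : Y => r • y) (i : ℕ) : Subsingleton (Abelian.Ext X Y i) := by
  have : IsIso (r • 𝟙 Y) := (ConcreteCategory.isIso_iff_bijective _).2 hY
  have hr : r • 𝟙 X = 0 := by
    ext x
    exact hX x
  refine subsingleton_of_forall_eq 0 fun x => ?_
  have h : r • x = 0 := by
    rw [← mk₀_id_comp x, ← smul_comp, ← mk₀_smul, hr, mk₀_zero, zero_comp]
  rw [smul_eq_comp_mk₀] at h
  have h' := congr_arg (fun z => z.comp (mk₀ (inv (r • 𝟙 Y))) (add_zero i)) h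
  simpa only [comp_assoc_of_third_deg_zero, mk₀_comp_mk₀, IsIso.hom_inv_id, comp_mk₀_id,
    zero_comp] using h'

end

section

variable {R : Type u} [CommRing R]
open Abelian.Ext

lemma span_range_pow_le {ι : Type*} [Finite ι] (α : ι → R) {I : Ideal R}
    (h : ∀ j, ∃ e : ℕ, α j ^ e ∈ I) : ∃ t : ℕ, Ideal.span (Set.range α) ^ t ≤ I :=
  Ideal.exists_pow_le_of_le_radical_of_fg
    (Ideal.span_le.2 (Set.range_subset_iff.2 h)) ⟨(Set.finite_range α).toFinset, by simp⟩

lemma exists_forall_mem_span_pow_smul_eq_zero {ι : Type*} [Finite ι] (α : ι → R) {M : Type*}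
    [AddCommGroup M] [Module R M] {m : M} (hm : ∀ j, ∃ e : ℕ, α j ^ e • m = 0) :
    ∃ t : ℕ, ∀ r ∈ Ideal.span (Set.range α) ^ t, r • m = 0 :=
  span_range_pow_le α (I := Ideal.torsionOf R M m) hm

lemma extLocallyZero_of_isWeaklyRegular {n : ℕ} {α : Fin n → R}
    (hreg : RingTheory.Sequence.IsWeaklyRegular R (List.ofFn α)) {M : ModuleCat.{u} R}
    (hM : ∀ j, ∀ m : M, ∃ e : ℕ, α j ^ e • m = 0) (i : ℕ) :
    ExtLocallyZero (Ideal.span (Set.range α)) M (i + 1) := by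
  intro t x
  let a (j : ℕ) : R := if h : j < n then α ⟨j, h⟩ else 0
  have ha (j : Fin n) : a j = α j := dif_pos j.2
  have ha' : (List.range n).map a = List.ofFn α := by
    apply List.ext_getElem (by simp)
    intro j h₁ h₂
    have hj : j < n := by simpa using h₁
    simp [a, hj]
  have hle : powersIdeal a n t ≤ Ideal.span (Set.range α) ^ t :=
    powersIdeal_le_iff.2 fun j hj => by
      rw [ha ⟨j, hj⟩]
      exact Ideal.pow_mem_pow (Ideal.subset_span (Set.mem_range_self _)) t
  obtain ⟨s, hs, h⟩ := exists_quotientProj_powersIdeal_comp_eq_zero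
    (fun j hj => isSMulRegular_powersIdeal (ha'.symm ▸ hreg) hj)
    (fun j hj => by
      rw [ha ⟨j, hj⟩]
      exact hM ⟨j, hj⟩) ((mk₀ (quotientProj hle)).comp x (zero_add _))
  obtain ⟨r, hr⟩ := span_range_pow_le α (I := powersIdeal a n s) fun j =>
    ⟨s, ha j ▸ pow_mem_powersIdeal a j.2 s⟩
  have hr' : Ideal.span (Set.range α) ^ (max t r) ≤ powersIdeal a n s :=
    (Ideal.pow_le_pow_right (le_max_right t r)).trans hr
  refine ⟨max t r, le_max_left t r, ?_⟩
  rw [quotientProj_comp_ext] at h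
  rw [← quotientProj_comp_ext hr' ((powersIdeal_anti a n hs).trans hle), h, comp_zero]

end

lemma exists_pow_smul_eq_zero_quotient_range_localization {R : Type*} [CommRing R] (a : R)
    {M : Type*} [AddCommGroup M] [Module R M] {b : R}
    (hb : b = a ∨ ∀ m : M, ∃ t : ℕ, b ^ t • m = 0)
    (c : LocalizedModule (Submonoid.powers a) M ⧸
      LinearMap.range (LocalizedModule.mkLinearMap (Submonoid.powers a) M)) :
    ∃ t : ℕ, b ^ t • c = 0 := by
  obtain ⟨l, rfl⟩ := Submodule.Quotient.mk_surjective _ c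
  induction l using LocalizedModule.induction_on with
  | _ m s =>
  simp only [← Submodule.Quotient.mk_smul, Submodule.Quotient.mk_eq_zero]
  obtain rfl | hb := hb
  · obtain ⟨_, t, rfl⟩ := s
    refine ⟨t, m, ?_⟩
    rw [LocalizedModule.mkLinearMap_apply, LocalizedModule.smul'_mk]
    exact (LocalizedModule.mk_cancel ⟨b ^ t, Submonoid.mem_powers_iff _ _ |>.2 ⟨t, rfl⟩⟩ m).symm
  · obtain ⟨t, ht⟩ := hb m
    refine ⟨t, ?_⟩
    rw [LocalizedModule.smul'_mk, ht, LocalizedModule.zero_mk]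
    exact zero_mem _

lemma exists_pow_smul_eq_zero_of_mkLinearMap_eq_zero {R : Type*} [CommRing R] (a : R)
    {M : Type*} [AddCommGroup M] [Module R M] {m : M}
    (hm : LocalizedModule.mkLinearMap (Submonoid.powers a) M m = 0) :
    ∃ t : ℕ, a ^ t • m = 0 := by
  obtain ⟨_, ⟨t, rfl⟩, ht⟩ := LocalizedModule.mem_ker_mkLinearMap_iff.1 hm
  exact ⟨t, ht⟩

/-- For a regular sequence `α_0, …, α_n` (`n ≥ 1`) of non-zero-divisors
generating `I`, and an `R`-module `M` on which each `α_j` with `j ≤ n - 1` acts locally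
nilpotently: `H_I^0(M)` is the submodule of `α_n`-power torsion elements, `H_I^1(M)` is the
cokernel of the localization map `M → M[1/α_n]`, and `H_I^i(M) = 0` for `i ≥ 2`. -/
theorem stmt16 {R : Type u} [CommRing R] (n : ℕ) (hn : 1 ≤ n) (α : Fin (n + 1) → R)
    (hreg : RingTheory.Sequence.IsWeaklyRegular R (List.ofFn α))
    (hnzd : ∀ i, α i ∈ nonZeroDivisors R)
    (M : Type u) [AddCommGroup M] [Module R M]
    (htors : ∀ j : Fin (n + 1), (j : ℕ) < n → ∀ m : M, ∃ t : ℕ, α j ^ t • m = 0) :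
    Nonempty (((localCohomology (Ideal.span (Set.range α)) 0).obj (ModuleCat.of R M)) ≃ₗ[R]
      powersTorsionBy (α (Fin.last n)) M) ∧
    Nonempty (((localCohomology (Ideal.span (Set.range α)) 1).obj (ModuleCat.of R M)) ≃ₗ[R]
      (LocalizedModule (Submonoid.powers (α (Fin.last n))) M ⧸
        LinearMap.range (LocalizedModule.mkLinearMap (Submonoid.powers (α (Fin.last n))) M))) ∧
    (∀ i : ℕ, 2 ≤ i →
      Subsingleton ((localCohomology (Ideal.span (Set.range α)) i).obj (ModuleCat.of R M))) := by
  set J := Ideal.span (Set.range α)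
  set S := Submonoid.powers (α (Fin.last n))
  let ℓ := LocalizedModule.mkLinearMap S M
  have hlast (j : Fin (n + 1)) : j = Fin.last n ∨ (j : ℕ) < n :=
    (Fin.eq_castSucc_or_eq_last j).symm.imp id (by rintro ⟨j, rfl⟩; exact j.2)
  have hS₁ : (ShortComplex.mk (ModuleCat.ofHom (LinearMap.ker ℓ).subtype)
      (ModuleCat.ofHom ℓ.rangeRestrict) (by
        ext x
        exact LinearMap.mem_ker.1 x.2)).ShortExact :=
    { exact := by
        rw [ShortComplex.moduleCat_exact_iff]
        intro x hx
        exact ⟨⟨x, congr_arg Subtype.val hx⟩, rfl⟩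
      mono_f := (ModuleCat.mono_iff_injective _).2 Subtype.val_injective
      epi_g := (ModuleCat.epi_iff_surjective _).2 ℓ.surjective_rangeRestrict }
  have hS₂ : (ShortComplex.mk (ModuleCat.ofHom (LinearMap.range ℓ).subtype)
      (ModuleCat.ofHom (LinearMap.range ℓ).mkQ) (by
        ext x
        exact (Submodule.Quotient.mk_eq_zero _).2 x.2)).ShortExact :=
    { exact := by
        rw [ShortComplex.moduleCat_exact_iff]
        intro x hx
        exact ⟨⟨x, (Submodule.Quotient.mk_eq_zero _).1 hx⟩, rfl⟩
      mono_f := (ModuleCat.mono_iff_injective _).2 Subtype.val_injective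
      epi_g := (ModuleCat.epi_iff_surjective _).2 (Submodule.mkQ_surjective _) }
  have hT (j) (m : LinearMap.ker ℓ) : ∃ t : ℕ, α j ^ t • m = 0 := by
    obtain ⟨t, ht⟩ : ∃ t : ℕ, α j ^ t • (m : M) = 0 := by
      obtain rfl | hj := hlast j
      · exact exists_pow_smul_eq_zero_of_mkLinearMap_eq_zero _ m.2
      · exact htors j hj m
    exact ⟨t, Subtype.ext ht⟩
  have hC (j) (c : LocalizedModule S M ⧸ LinearMap.range ℓ) : ∃ t : ℕ, α j ^ t • c = 0 :=
    exists_pow_smul_eq_zero_quotient_range_localization _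
      ((hlast j).imp (congr_arg α) (htors j)) c
  have hL (t i) : Subsingleton
      (Abelian.Ext (ModuleCat.of R (R ⧸ J ^ t)) (ModuleCat.of R (LocalizedModule S M)) i) := by
    refine subsingleton_ext_of_smul (r := α (Fin.last n) ^ t) (fun x => ?_) ?_ i
    · obtain ⟨x, rfl⟩ := Submodule.Quotient.mk_surjective _ x
      exact (Submodule.Quotient.mk_eq_zero _).2
        (Ideal.mul_mem_right _ _ (Ideal.pow_mem_pow (Ideal.subset_span (Set.mem_range_self _)) t))
    · exact (Module.End.isUnit_iff _).1
        (IsLocalizedModule.map_units ℓ ⟨α (Fin.last n) ^ t, Submonoid.mem_powers_iff _ _ |>.2 ⟨t, rfl⟩⟩)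
  have hT' := extLocallyZero_of_isWeaklyRegular hreg (M := ModuleCat.of R (LinearMap.ker ℓ)) hT
  have hC' := extLocallyZero_of_isWeaklyRegular hreg
    (M := ModuleCat.of R (LocalizedModule S M ⧸ LinearMap.range ℓ)) hC
  refine ⟨nonempty_localCohomology_zero_linearEquiv fun m => ⟨?_, ?_⟩,
    nonempty_localCohomology_one_linearEquiv hS₁ hS₂ (hT' 0) (hT' 1) hL
      fun c => exists_forall_mem_span_pow_smul_eq_zero α fun j => hC j c, fun i hi => ?_⟩
  · intro hm
    refine exists_forall_mem_span_pow_smul_eq_zero α fun j => ?_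
    obtain rfl | hj := hlast j
    · exact hm
    · exact htors j hj m
  · rintro ⟨t, ht⟩
    exact ⟨t, ht _ (Ideal.pow_mem_pow (Ideal.subset_span (Set.mem_range_self _)) t)⟩
  · obtain ⟨i, rfl⟩ := Nat.exists_eq_add_of_le' hi
    exact subsingleton_localCohomology _ _ _ (ExtLocallyZero.of_shortExact hS₁ (hT' (i + 1))
      (ExtLocallyZero.of_subsingleton_s16 hS₂ (hC' i) fun t => hL t _))
end
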